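/- Let C be an algebra of global dimension 2, B = C ⋉ Ext^2_C(DC,C), and M a partial tilting C-module with pd_C τ_C M ≤ 1. Then M is τ_B-rigid if and only if Hom_C(τ_C^{-1}Ω_C^{-1}M, Gen M) = 0, i.e. Hom_C(τ_C^{-1}Ω_C^{-1}M, X) = 0 for every X generated by M. -/

import Mathlib

open CategoryTheory MulOpposite

open CategoryTheory MulOpposite

/-! Core definitions: right `A`-modules are modules over `Aᵐᵒᵖ`. -/

/-- The category of (small) modules over a ring `R`.  For a `k`-algebra `A`,
right `A`-modules are `Mdl Aᵐᵒᵖ`. -/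
abbrev Mdl (R : Type) [Ring R] := ModuleCat.{0} R

section Generic

variable (R : Type) [Ring R]

/-- `f : P → M` is a projective cover: `P` projective, `f` surjective with
superfluous kernel. -/
def IsProjCover {P M : Mdl R} (f : P →ₗ[R] M) : Prop :=
  Module.Projective R P ∧ Function.Surjective f ∧
    ∀ N : Submodule R P, N ⊔ LinearMap.ker f = ⊤ → N = ⊤

/-- `f : M → I` is an injective envelope: `I` injective, `f` injective with
essential image. -/
def IsInjEnv {M I : Mdl R} (f : M →ₗ[R] I) : Prop :=
  Module.Injective R I ∧ Function.Injective f ∧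
    ∀ K : Submodule R I, K ⊓ LinearMap.range f = ⊥ → K = ⊥

/-- `Hom_R(X, Y) = 0`. -/
def HomZero (X Y : Mdl R) : Prop := ∀ f : X →ₗ[R] Y, f = 0

/-- `X ∈ Gen M`: `X` is an epimorphic image of a finite direct sum of copies of `M`. -/
def MemGen (M X : Mdl R) : Prop :=
  ∃ (d : ℕ) (f : (Fin d → M) →ₗ[R] X), Function.Surjective f

/-- `X ∈ add M`: `X` is a direct summand of a finite direct sum of copies of `M`. -/
def MemAdd (M X : Mdl R) : Prop :=
  ∃ (n : ℕ) (s : X →ₗ[R] (Fin n → M)) (r : (Fin n → M) →ₗ[R] X),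
    r.comp s = LinearMap.id

/-- projective dimension at most 1: a length-one projective resolution exists. -/
def PdLE1 (M : Mdl R) : Prop :=
  ∃ (P1 P0 : Mdl R) (d1 : P1 →ₗ[R] P0) (d0 : P0 →ₗ[R] M),
    Module.Projective R P1 ∧ Module.Projective R P0 ∧
    Function.Injective d1 ∧ Function.Surjective d0 ∧
    LinearMap.range d1 = LinearMap.ker d0

/-- projective dimension at most 2. -/
def PdLE2 (M : Mdl R) : Prop :=
  ∃ (P2 P1 P0 : Mdl R) (d2 : P2 →ₗ[R] P1) (d1 : P1 →ₗ[R] P0) (d0 : P0 →ₗ[R] M),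
    Module.Projective R P2 ∧ Module.Projective R P1 ∧ Module.Projective R P0 ∧
    Function.Injective d2 ∧ Function.Surjective d0 ∧
    LinearMap.range d2 = LinearMap.ker d1 ∧ LinearMap.range d1 = LinearMap.ker d0

/-- injective dimension at most 1. -/
def IdLE1 (M : Mdl R) : Prop :=
  ∃ (I0 I1 : Mdl R) (d0 : M →ₗ[R] I0) (d1 : I0 →ₗ[R] I1),
    Module.Injective R I0 ∧ Module.Injective R I1 ∧
    Function.Injective d0 ∧ Function.Surjective d1 ∧
    LinearMap.range d0 = LinearMap.ker d1

/-- global dimension at most 2 (every module has projective dimension ≤ 2). -/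
def GlDimLE2 : Prop := ∀ M : Mdl R, PdLE2 R M

/-- global dimension exactly 2. -/
def GlDimEq2 : Prop := GlDimLE2 R ∧ ¬ ∀ M : Mdl R, PdLE1 R M

/-- `W` is a first syzygy `Ω M` of `M` (kernel of a projective cover). -/
def IsSyzygy (M W : Mdl R) : Prop :=
  ∃ (P : Mdl R) (f : P →ₗ[R] M), IsProjCover R f ∧
    Nonempty (W ≃ₗ[R] LinearMap.ker f)

/-- `W` is a first cosyzygy `Ω⁻¹ M` of `M` (cokernel of an injective envelope). -/
def IsCosyzygy (M W : Mdl R) : Prop :=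
  ∃ (I : Mdl R) (f : M →ₗ[R] I), IsInjEnv R f ∧
    Nonempty (W ≃ₗ[R] (I ⧸ LinearMap.range f))

/-- `P1 --d1--> P0 --d0--> M → 0` is a minimal projective presentation. -/
def IsMinPres {P1 P0 M : Mdl R} (d1 : P1 →ₗ[R] P0) (d0 : P0 →ₗ[R] M) : Prop :=
  IsProjCover R d0 ∧ Module.Projective R P1 ∧
  LinearMap.range d1 = LinearMap.ker d0 ∧
  ∀ N : Submodule R P1, N ⊔ LinearMap.ker d1 = ⊤ → N = ⊤

/-- `Ext¹_R(X, Y) = 0`, expressed as: every short exact sequence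
`0 → Y → Z → X → 0` splits. -/
def Ext1Zero (X Y : Mdl R) : Prop :=
  ∀ (Z : Mdl R) (i : Y →ₗ[R] Z) (p : Z →ₗ[R] X),
    Function.Injective i → Function.Surjective p →
    LinearMap.range i = LinearMap.ker p →
    ∃ s : X →ₗ[R] Z, p.comp s = LinearMap.id

/-- partial tilting module: `pd ≤ 1` and `Ext¹(M,M) = 0`. -/
def PartialTilting (M : Mdl R) : Prop := PdLE1 R M ∧ Ext1Zero R M M

/-- tilting module: partial tilting plus a coresolution
`0 → R → T' → T'' → 0` with `T', T'' ∈ add M` of the regular module. -/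
def IsTilting (M : Mdl R) : Prop :=
  PartialTilting R M ∧
  ∃ (T' T'' : Mdl R) (i : ModuleCat.of R R →ₗ[R] T') (p : T' →ₗ[R] T''),
    MemAdd R M T' ∧ MemAdd R M T'' ∧
    Function.Injective i ∧ Function.Surjective p ∧
    LinearMap.range i = LinearMap.ker p

/-- an indecomposable (nonzero) module. -/
def Indecomp (M : Mdl R) : Prop :=
  Nontrivial M ∧ ∀ (U V : Submodule R M), IsCompl U V → U = ⊥ ∨ V = ⊥

/-- the number of isomorphism classes of simple `R`-modules is `n`. -/
def SimpleCount (n : ℕ) : Prop :=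
  ∃ S : Fin n → Mdl R,
    (∀ i, IsSimpleModule R (S i)) ∧
    (∀ i j, Nonempty ((S i) ≃ₗ[R] (S j)) → i = j) ∧
    ∀ X : Mdl R, IsSimpleModule R X → ∃ i, Nonempty (X ≃ₗ[R] S i)

end Generic

section Duality

variable (k : Type) [Field k] (A : Type) [Ring A] [Algebra k A]

/-- `N` (a right `A`-module) is the `k`-linear dual `D M` of the left `A`-module `M`:
witnessed by a nondegenerate balanced `k`-bilinear pairing. -/
def IskDual (N : Mdl Aᵐᵒᵖ) (M : Mdl A) : Prop :=
  ∃ φ : N → M → k,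
    (∀ n n' m, φ (n + n') m = φ n m + φ n' m) ∧
    (∀ n m m', φ n (m + m') = φ n m + φ n m') ∧
    (∀ (c : k) n m, φ n ((algebraMap k A c) • m) = c * φ n m) ∧
    (∀ (a : A) n m, φ (op a • n) m = φ n (a • m)) ∧
    (∀ n, (∀ m, φ n m = 0) → n = 0) ∧
    (∀ m, (∀ n, φ n m = 0) → m = 0)

/-- `T = τ M`: the Auslander–Reiten translate of the right `A`-module `M`,
i.e. the `k`-dual of the transpose `Tr M` computed from a minimal projective
presentation. -/
def IsTau (M T : Mdl Aᵐᵒᵖ) : Prop :=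
  ∃ (P1 P0 : Mdl Aᵐᵒᵖ) (d1 : P1 →ₗ[Aᵐᵒᵖ] P0) (d0 : P0 →ₗ[Aᵐᵒᵖ] M),
    IsMinPres Aᵐᵒᵖ d1 d0 ∧
    ∃ (Tr : Mdl A) (q : (P1 →ₗ[Aᵐᵒᵖ] A) →ₗ[A] Tr),
      Function.Surjective q ∧
      (∀ g : P1 →ₗ[Aᵐᵒᵖ] A, q g = 0 ↔ ∃ f : P0 →ₗ[Aᵐᵒᵖ] A, g = f.comp d1) ∧
      IskDual k A T Tr

/-- `T = τ⁻¹ M`: the inverse Auslander–Reiten translate, `Tr (D M)`, computed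
from a minimal projective presentation of the left module `D M`. -/
def IsTauInv (M T : Mdl Aᵐᵒᵖ) : Prop :=
  ∃ (DM : Mdl A), IskDual k A M DM ∧
  ∃ (Q1 Q0 : Mdl A) (d1 : Q1 →ₗ[A] Q0) (d0 : Q0 →ₗ[A] DM),
    IsMinPres A d1 d0 ∧
    ∃ q : (Q1 →ₗ[A] A) →ₗ[Aᵐᵒᵖ] T,
      Function.Surjective q ∧
      ∀ g : Q1 →ₗ[A] A, q g = 0 ↔ ∃ f : Q0 →ₗ[A] A, g = f.comp d1

/-- `W = τ⁻¹ Ω⁻¹ M`. -/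
def IsTauInvCosyz (M W : Mdl Aᵐᵒᵖ) : Prop :=
  ∃ V, IsCosyzygy Aᵐᵒᵖ M V ∧ IsTauInv k A V W

/-- `W = τ Ω M`. -/
def IsTauSyz (M W : Mdl Aᵐᵒᵖ) : Prop :=
  ∃ V, IsSyzygy Aᵐᵒᵖ M V ∧ IsTau k A V W

/-- `M` is `τ`-rigid: `Hom(M, τM) = 0`. -/
def TauRigid (M : Mdl Aᵐᵒᵖ) : Prop :=
  ∀ T, IsTau k A M T → HomZero Aᵐᵒᵖ M T

/-- `M` is `τ`-tilting: `τ`-rigid with as many pairwise nonisomorphic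
indecomposable summands as there are simple modules. -/
def TauTilting (M : Mdl Aᵐᵒᵖ) : Prop :=
  TauRigid k A M ∧
  ∃ (n : ℕ) (N : Fin n → Mdl Aᵐᵒᵖ),
    (∀ i, Indecomp Aᵐᵒᵖ (N i)) ∧
    (∀ i j, Nonempty ((N i) ≃ₗ[Aᵐᵒᵖ] (N j)) → i = j) ∧
    Nonempty (M ≃ₗ[Aᵐᵒᵖ] ((i : Fin n) → N i)) ∧
    SimpleCount Aᵐᵒᵖ n

end Duality


section SplitExt

variable {B C : Type} [Ring B] [Ring C]

/-- a right `C`-module viewed as a right `B`-module via a ring hom `π : B → C`. -/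
def modAlong (π : B →+* C) (M : Mdl Cᵐᵒᵖ) : Mdl Bᵐᵒᵖ :=
  letI : Module Bᵐᵒᵖ M := Module.compHom M (RingHom.op π)
  ModuleCat.of _ M

/-- `X` is the induced module `M ⊗_C B` along `σ : C → B`, characterized by the
universal property of induction (extension of scalars). -/
def IsInducedAlong (σ : C →+* B) (M : Mdl Cᵐᵒᵖ) (X : Mdl Bᵐᵒᵖ) : Prop :=
  ∃ φ : M →+ X,
    (∀ (c : C) (m : M), φ (op c • m) = op (σ c) • φ m) ∧
    ∀ (Y : Mdl Bᵐᵒᵖ) (ψ : M →+ Y),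
      (∀ (c : C) (m : M), ψ (op c • m) = op (σ c) • ψ m) →
      ∃! h : X →ₗ[Bᵐᵒᵖ] Y, ∀ m, h (φ m) = ψ m

/-- `X` is the coinduced module `D(B ⊗_C D M) ≅ Hom_C(B, M)` along `σ : C → B`,
characterized by the universal property of coinduction. -/
def IsCoinducedAlong (σ : C →+* B) (M : Mdl Cᵐᵒᵖ) (X : Mdl Bᵐᵒᵖ) : Prop :=
  ∃ p : X →+ M,
    (∀ (c : C) (x : X), p (op (σ c) • x) = op c • p x) ∧
    ∀ (Y : Mdl Bᵐᵒᵖ) (ψ : Y →+ M),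
      (∀ (c : C) (y : Y), ψ (op (σ c) • y) = op c • ψ y) →
      ∃! h : Y →ₗ[Bᵐᵒᵖ] X, ∀ y, p (h y) = ψ y

end SplitExt

section TrivExt

variable (C : Type) [Ring C] (E : Type) [AddCommGroup E]
  [Module C E] [Module Cᵐᵒᵖ E] [SMulCommClass C Cᵐᵒᵖ E]

/-- the projection `B = C ⋉ E → C` as a ring hom. -/
def tszeFst : TrivSqZeroExt C E →+* C where
  toFun := TrivSqZeroExt.fst
  map_one' := rfl
  map_mul' _ _ := rfl
  map_zero' := rfl
  map_add' _ _ := rfl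

/-- the inclusion `σ : C → B = C ⋉ E` as a ring hom. -/
def tszeInl : C →+* TrivSqZeroExt C E where
  toFun := TrivSqZeroExt.inl
  map_one' := rfl
  map_mul' x y := TrivSqZeroExt.inl_mul (M := E) x y
  map_zero' := TrivSqZeroExt.inl_zero (M := E)
  map_add' x y := TrivSqZeroExt.inl_add (M := E) x y

/-- a right `C`-module viewed as a module over the trivial extension `C ⋉ E`. -/
def modB (M : Mdl Cᵐᵒᵖ) : Mdl (TrivSqZeroExt C E)ᵐᵒᵖ :=
  modAlong (tszeFst C E) M

/-- `X = M ⊗_C B` for `B = C ⋉ E`. -/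
def IsInduced (M : Mdl Cᵐᵒᵖ) (X : Mdl (TrivSqZeroExt C E)ᵐᵒᵖ) : Prop :=
  IsInducedAlong (tszeInl C E) M X

/-- `X = D(B ⊗_C D M)` for `B = C ⋉ E`. -/
def IsCoinduced (M : Mdl Cᵐᵒᵖ) (X : Mdl (TrivSqZeroExt C E)ᵐᵒᵖ) : Prop :=
  IsCoinducedAlong (tszeInl C E) M X

end TrivExt

section RelExt

variable (k : Type) [Field k] (C : Type) [Ring C] [Algebra k C]
  (E : Type) [AddCommGroup E] [Module C E] [Module Cᵐᵒᵖ E]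

/-- The `C`-`C`-bimodule `E` is `Ext²_C(DC, C)`: there is a projective
resolution `0 → P2 → P1 → P0 → DC → 0` of the right module `DC = Hom_k(C,k)`
(characterized by a nondegenerate balanced pairing `φ` with `C`), and `E` is
the cokernel of `Hom_C(P1, C) → Hom_C(P2, C)` as a left `C`-module, with the
right `C`-action on `E` induced (contravariantly, via lifts of the left action
on `DC`) by functoriality of `Ext²(-, C)`. -/
def IsRelExt : Prop :=
  ∃ (DC : Mdl Cᵐᵒᵖ) (φ : DC → C → k),
    (∀ n n' m, φ (n + n') m = φ n m + φ n' m) ∧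
    (∀ n m m', φ n (m + m') = φ n m + φ n m') ∧
    (∀ (c : k) n m, φ n ((algebraMap k C c) * m) = c * φ n m) ∧
    (∀ (a : C) n m, φ (op a • n) m = φ n (a * m)) ∧
    (∀ n, (∀ m, φ n m = 0) → n = 0) ∧
    (∀ m, (∀ n, φ n m = 0) → m = 0) ∧
    ∃ (P2 P1 P0 : Mdl Cᵐᵒᵖ) (d2 : P2 →ₗ[Cᵐᵒᵖ] P1) (d1 : P1 →ₗ[Cᵐᵒᵖ] P0)
      (d0 : P0 →ₗ[Cᵐᵒᵖ] DC),
      Module.Projective Cᵐᵒᵖ P2 ∧ Module.Projective Cᵐᵒᵖ P1 ∧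
      Module.Projective Cᵐᵒᵖ P0 ∧
      Function.Injective d2 ∧ Function.Surjective d0 ∧
      LinearMap.range d2 = LinearMap.ker d1 ∧
      LinearMap.range d1 = LinearMap.ker d0 ∧
      ∃ q : (P2 →ₗ[Cᵐᵒᵖ] C) →ₗ[C] E,
        Function.Surjective q ∧
        (∀ g : P2 →ₗ[Cᵐᵒᵖ] C, q g = 0 ↔ ∃ f : P1 →ₗ[Cᵐᵒᵖ] C, g = f.comp d2) ∧
        ∀ c : C, ∃ (μ : DC →ₗ[Cᵐᵒᵖ] DC) (f0 : P0 →ₗ[Cᵐᵒᵖ] P0)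
            (f1 : P1 →ₗ[Cᵐᵒᵖ] P1) (f2 : P2 →ₗ[Cᵐᵒᵖ] P2),
          (∀ n x, φ (μ n) x = φ n (x * c)) ∧
          d0.comp f0 = μ.comp d0 ∧
          d1.comp f1 = f0.comp d1 ∧
          d2.comp f2 = f1.comp d2 ∧
          ∀ g : P2 →ₗ[Cᵐᵒᵖ] C, q (g.comp f2) = op c • q g

end RelExt



open CategoryTheory MulOpposite

set_option linter.style.haveILetI false

namespace PT

section Basic
variable {R : Type} [Ring R]
variable {A B X Y : Type} [AddCommGroup A] [AddCommGroup B] [AddCommGroup X] [AddCommGroup Y]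
  [Module R A] [Module R B] [Module R X] [Module R Y]

/-- maps factor through surjections when the kernel is killed. -/
theorem factor_surj (s : A →ₗ[R] B) (hs : Function.Surjective s) (t : A →ₗ[R] X)
    (h : ∀ a, s a = 0 → t a = 0) : ∃ t' : B →ₗ[R] X, ∀ a, t' (s a) = t a := by
  have hk : LinearMap.ker s ≤ LinearMap.ker t := fun a ha => h a ha
  let e := s.quotKerEquivOfSurjective hs
  refine ⟨((LinearMap.ker s).liftQ t hk).comp e.symm.toLinearMap, fun a => ?_⟩
  have : e.symm (s a) = (LinearMap.ker s).mkQ a := by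
    rw [LinearEquiv.symm_apply_eq]; rfl
  simp only [LinearMap.comp_apply, LinearEquiv.coe_coe, this]
  simp

/-- maps landing in the image of an injection factor through it. -/
theorem factor_inj (i : A →ₗ[R] B) (hi : Function.Injective i) (t : X →ₗ[R] B)
    (h : ∀ x, ∃ a, i a = t x) : ∃ t' : X →ₗ[R] A, ∀ x, i (t' x) = t x := by
  choose f hf using h
  refine ⟨{ toFun := f, map_add' := ?_, map_smul' := ?_ }, hf⟩
  · intro x y; apply hi; simp [hf]
  · intro c x; apply hi; simp [hf]

theorem proj_lift {P : Type} [AddCommGroup P] [Module R P] (hP : Module.Projective R P)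
    (s : A →ₗ[R] B) (t : P →ₗ[R] B) (h : ∀ p, ∃ a, s a = t p) :
    ∃ t' : P →ₗ[R] A, ∀ p, s (t' p) = t p := by
  let s' := s.rangeRestrict
  obtain ⟨t', ht'⟩ := Module.projective_lifting_property s'
    (t.codRestrict (LinearMap.range s) (fun p => h p)) s.surjective_rangeRestrict
  refine ⟨t', fun p => ?_⟩
  have := LinearMap.congr_fun ht' p
  exact congrArg Subtype.val this

/-- exact extension: if `a = ker`-killing -/
theorem inj_ext (hI : Module.Injective R X) (i : A →ₗ[R] B) (t : A →ₗ[R] X)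
    (h : ∀ a, i a = 0 → t a = 0) : ∃ t' : B →ₗ[R] X, ∀ a, t' (i a) = t a := by
  obtain ⟨t1, ht1⟩ := factor_surj i.rangeRestrict i.surjective_rangeRestrict t
    (fun a ha => h a (congrArg Subtype.val ha))
  obtain ⟨t2, ht2⟩ := hI.out (LinearMap.range i).subtype (Submodule.subtype_injective _) t1
  refine ⟨t2, fun a => ?_⟩
  rw [← ht1, ← ht2]; rfl

theorem injective_of_retract (hI : Module.Injective R X) (i : Y →ₗ[R] X) (r : X →ₗ[R] Y)
    (h : ∀ y, r (i y) = y) : Module.Injective R Y := by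
  refine ⟨fun U V _ _ _ _ f hf g => ?_⟩
  obtain ⟨t, ht⟩ := hI.out f hf (i.comp g)
  exact ⟨r.comp t, fun x => by simp [ht, h]⟩

/-- Fitting: an idempotent-like decomposition. -/
theorem fitting [IsArtinian R A] [IsNoetherian R A] (φ : A →ₗ[R] A) :
    ∃ n : ℕ, 0 < n ∧ IsCompl (LinearMap.ker (φ ^ n)) (LinearMap.range (φ ^ n)) := by
  have h := LinearMap.eventually_isCompl_ker_pow_range_pow φ
  obtain ⟨n, hn⟩ := Filter.eventually_atTop.mp h
  exact ⟨n + 1, Nat.succ_pos _, hn _ (Nat.le_succ n)⟩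

end Basic

section Covers
variable {R : Type} [Ring R] [IsArtinianRing R]

theorem exists_projCover (M : Mdl R) [Module.Finite R M] :
    ∃ (P : Mdl R) (f : P →ₗ[R] M), Module.Finite R P ∧ IsProjCover R f := by
  classical
  let S : Set ℕ∞ := {n | ∃ (P : Mdl R) (f : P →ₗ[R] M), Module.Finite R P ∧ Module.Projective R P ∧
    Function.Surjective f ∧ Module.length R P = n}
  have hS : S.Nonempty := by
    obtain ⟨n, f, hf⟩ := Module.Finite.exists_fin' R M
    exact ⟨_, ModuleCat.of R (Fin n → R), f, inferInstanceAs (Module.Finite R (Fin n → R)),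
      inferInstanceAs (Module.Projective R (Fin n → R)), hf, rfl⟩
  obtain ⟨P, f, hfin, hproj, hf, hlen⟩ := WellFounded.min_mem (wellFounded_lt (α := ℕ∞)) S hS
  refine ⟨P, f, hfin, hproj, hf, fun N hN => ?_⟩
  by_contra hne
  have hsurj : ∀ p : P, ∃ x : N, (f.comp N.subtype) x = f p := by
    intro p
    have : p ∈ N ⊔ LinearMap.ker f := hN ▸ Submodule.mem_top
    obtain ⟨a, ha, b, hb, rfl⟩ := Submodule.mem_sup.mp this
    refine ⟨⟨a, ha⟩, ?_⟩
    have hb' : f b = 0 := hb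
    simp [hb']
  obtain ⟨t, ht⟩ := proj_lift hproj (f.comp N.subtype) f hsurj
  let φ : P →ₗ[R] P := N.subtype.comp t
  have hφ : ∀ p, f (φ p) = f p := ht
  obtain ⟨n, hn0, hn⟩ := fitting φ
  have hφn : ∀ m, ∀ p, f ((φ ^ m) p) = f p := by
    intro m
    induction m with
    | zero => intro p; simp
    | succ m ih => intro p; rw [pow_succ, Module.End.mul_apply, ih, hφ]
  let Rg := LinearMap.range (φ ^ n)
  have hRN : Rg ≤ N := by
    rintro _ ⟨p, rfl⟩
    obtain ⟨m, rfl⟩ := Nat.exists_eq_succ_of_ne_zero hn0.ne'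
    rw [Nat.succ_eq_add_one, pow_succ', Module.End.mul_apply]
    exact (t _).2
  have hRtop : Rg ≠ ⊤ := fun h => hne (top_le_iff.mp (h ▸ hRN))
  have hPR : Module.Projective R Rg := by
    refine Module.Projective.of_split Rg.subtype (Rg.projectionOnto _ hn.symm) ?_
    ext x; simp
  have hmem : Module.length R Rg ∈ S := by
    refine ⟨ModuleCat.of R Rg, f.comp Rg.subtype, inferInstanceAs (Module.Finite R Rg), hPR, ?_, rfl⟩
    intro m
    obtain ⟨p, rfl⟩ := hf m
    exact ⟨⟨(φ ^ n) p, p, rfl⟩, hφn n p⟩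
  have hlt : Module.length R Rg < Module.length R P := by
    apply Submodule.length_lt
    exact hRtop
  rw [hlen] at hlt
  exact WellFounded.not_lt_min (wellFounded_lt (α := ℕ∞)) S hmem hlt

theorem exists_minPres (M : Mdl R) [Module.Finite R M] :
    ∃ (P1 P0 : Mdl R) (d1 : P1 →ₗ[R] P0) (d0 : P0 →ₗ[R] M),
      Module.Finite R P1 ∧ Module.Finite R P0 ∧ IsMinPres R d1 d0 := by
  obtain ⟨P0, d0, hf0, hc0⟩ := exists_projCover M
  haveI : Module.Finite R (ModuleCat.of R (LinearMap.ker d0)) :=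
    inferInstanceAs (Module.Finite R (LinearMap.ker d0))
  obtain ⟨P1, e, hf1, hc1⟩ := exists_projCover (ModuleCat.of R (LinearMap.ker d0))
  let e' : P1 →ₗ[R] LinearMap.ker d0 := e
  have he : Function.Surjective e' := hc1.2.1
  refine ⟨P1, P0, (LinearMap.ker d0).subtype.comp e', d0, hf1, hf0, hc0, hc1.1, ?_, ?_⟩
  · rw [LinearMap.range_comp, LinearMap.range_eq_top.mpr he]; simp
  · intro N hN
    apply hc1.2.2 N
    rw [LinearMap.ker_comp] at hN
    simpa using hN

theorem exists_injEnv (M J : Mdl R) [Module.Finite R J] (hJ : Module.Injective R J)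
    (g : M →ₗ[R] J) (hg : Function.Injective g) :
    ∃ (I : Mdl R) (f : M →ₗ[R] I), Module.Finite R I ∧ IsInjEnv R f := by
  classical
  let S : Set ℕ∞ := {n | ∃ (P : Mdl R) (f : M →ₗ[R] P), Module.Finite R P ∧ Module.Injective R P ∧
    Function.Injective f ∧ Module.length R P = n}
  have hS : S.Nonempty := ⟨_, J, g, inferInstance, hJ, hg, rfl⟩
  obtain ⟨I, f, hfin, hinj, hf, hlen⟩ := WellFounded.min_mem (wellFounded_lt (α := ℕ∞)) S hS
  refine ⟨I, f, hfin, hinj, hf, fun K hK => ?_⟩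
  by_contra hne
  obtain ⟨t, ht⟩ := inj_ext hinj (K.mkQ.comp f) f (by
    intro m hm
    have h1 : f m ∈ K := by simpa using hm
    have : f m ∈ K ⊓ LinearMap.range f := ⟨h1, m, rfl⟩
    rw [hK] at this
    simpa using this)
  let φ : I →ₗ[R] I := t.comp K.mkQ
  have hφ : ∀ m, φ (f m) = f m := ht
  obtain ⟨n, hn0, hn⟩ := fitting φ
  have hφn : ∀ j, ∀ m, (φ ^ j) (f m) = f m := by
    intro j
    induction j with
    | zero => intro p; simp
    | succ m ih => intro p; rw [pow_succ, Module.End.mul_apply, hφ, ih]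
  let Rg := LinearMap.range (φ ^ n)
  have hRtop : Rg ≠ ⊤ := by
    intro h
    have hk : LinearMap.ker (φ ^ n) = ⊥ := by
      have := hn.disjoint
      rw [show LinearMap.range (φ ^ n) = ⊤ from h] at this
      exact disjoint_top.mp this
    apply hne
    rw [eq_bot_iff]
    intro x hx
    rw [← hk, LinearMap.mem_ker]
    obtain ⟨m, rfl⟩ := Nat.exists_eq_succ_of_ne_zero hn0.ne'
    rw [Nat.succ_eq_add_one, pow_succ, Module.End.mul_apply]
    have : φ x = 0 := by
      change t (K.mkQ x) = 0
      rw [show K.mkQ x = 0 by simpa using hx, map_zero]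
    rw [this, map_zero]
  have hPR : Module.Injective R Rg :=
    injective_of_retract hinj Rg.subtype (Rg.projectionOnto _ hn.symm) (by intro x; simp)
  obtain ⟨f', hf'⟩ := factor_inj Rg.subtype (Submodule.subtype_injective _) f
    (fun m => ⟨⟨f m, f m, hφn n m⟩, rfl⟩)
  have hmem : Module.length R Rg ∈ S := by
    refine ⟨ModuleCat.of R Rg, f', inferInstanceAs (Module.Finite R Rg), hPR, ?_, rfl⟩
    intro a b hab
    apply hf
    rw [← hf', ← hf']
    exact congrArg _ hab
  have hlt : Module.length R Rg < Module.length R I := by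
    apply Submodule.length_lt
    exact hRtop
  rw [hlen] at hlt
  exact WellFounded.not_lt_min (wellFounded_lt (α := ℕ∞)) S hmem hlt

end Covers
end PT

open CategoryTheory MulOpposite

namespace PT

section KStr
variable (k : Type) [Field k] (R : Type) [Ring R] [Algebra k R]

/-- the underlying `k`-structure of an `R`-module. -/
abbrev kMod (N : Type) [AddCommGroup N] [Module R N] : Module k N :=
  Module.compHom N (algebraMap k R)

theorem kMod_tower (N : Type) [AddCommGroup N] [Module R N] :
    letI := kMod k R N
    IsScalarTower k R N := by
  letI := kMod k R N
  refine ⟨fun c r n => ?_⟩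
  change (c • r) • n = (algebraMap k R c) • (r • n)
  rw [Algebra.smul_def, mul_smul]

theorem finite_k [FiniteDimensional k R] (N : Type) [AddCommGroup N] [Module R N]
    [Module.Finite R N] : letI := kMod k R N; Module.Finite k N := by
  letI := kMod k R N
  haveI := kMod_tower k R N
  exact Module.Finite.trans R N

theorem finite_of_k (N : Type) [AddCommGroup N] [Module R N]
    (h : letI := kMod k R N; Module.Finite k N) : Module.Finite R N := by
  letI := kMod k R N
  haveI := kMod_tower k R N
  haveI : Module.Finite k N := h
  exact Module.Finite.of_restrictScalars_finite k R N

variable {k R}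
/-- extension of functionals. -/
theorem functional_ext {A B : Type} [AddCommGroup A] [AddCommGroup B] [Module R A] [Module R B]
    (i : A →ₗ[R] B) (f : A →+ k)
    (hf : ∀ (c : k) a, f (algebraMap k R c • a) = c * f a) (h : ∀ a, i a = 0 → f a = 0) :
    ∃ g : B →+ k, (∀ (c : k) b, g (algebraMap k R c • b) = c * g b) ∧ ∀ a, g (i a) = f a := by
  letI := kMod k R A
  letI := kMod k R B
  let i' : A →ₗ[k] B := { toFun := i, map_add' := map_add i, map_smul' := fun c a => map_smul i _ a }
  let f' : A →ₗ[k] k := { toFun := f, map_add' := map_add f, map_smul' := fun c a => hf c a }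
  have hk : LinearMap.ker i' ≤ LinearMap.ker f' := fun a ha => h a ha
  obtain ⟨g, hg⟩ := LinearMap.exists_extend
    (((LinearMap.ker i').liftQ f' hk).comp i'.quotKerEquivRange.symm.toLinearMap)
  refine ⟨g.toAddMonoidHom, fun c b => ?_, fun a => ?_⟩
  · exact g.map_smul c b
  · have := LinearMap.congr_fun hg ⟨i' a, a, rfl⟩
    have h2 : i'.quotKerEquivRange.symm ⟨i' a, a, rfl⟩ = (LinearMap.ker i').mkQ a := by
      rw [LinearEquiv.symm_apply_eq]; rfl
    simp only [LinearMap.comp_apply, LinearEquiv.coe_coe, h2] at this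
    simp at this
    exact this

theorem functional_sep {A : Type} [AddCommGroup A] [Module R A] (a : A)
    (h : ∀ f : A →+ k, (∀ (c : k) a, f (algebraMap k R c • a) = c * f a) → f a = 0) : a = 0 := by
  letI := kMod k R A
  rw [← Module.forall_dual_apply_eq_zero_iff k]
  intro f
  exact h f.toAddMonoidHom (fun c a => f.map_smul c a)
end KStr

section Dual
variable (k : Type) [Field k] (A : Type) [Ring A] [Algebra k A]

/-- dual of a left module: a right module. -/
def DR (Q : Type) [AddCommGroup Q] [Module A Q] : AddSubgroup (Q →+ k) where
  carrier := {f | ∀ (c : k) x, f (algebraMap k A c • x) = c * f x}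
  zero_mem' := by intro c x; simp
  add_mem' := by intro f g hf hg c x; simp [hf c x, hg c x, mul_add]
  neg_mem' := by intro f hf c x; simp [hf c x]

/-- dual of a right module: a left module. -/
def DL (X : Type) [AddCommGroup X] [Module Aᵐᵒᵖ X] : AddSubgroup (X →+ k) where
  carrier := {f | ∀ (c : k) x, f (algebraMap k Aᵐᵒᵖ c • x) = c * f x}
  zero_mem' := by intro c x; simp
  add_mem' := by intro f g hf hg c x; rw [AddMonoidHom.add_apply, AddMonoidHom.add_apply, hf c x, hg c x, mul_add]
  neg_mem' := by intro f hf c x; rw [AddMonoidHom.neg_apply, AddMonoidHom.neg_apply, hf c x, mul_neg]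

variable {k A}

instance DR.instModule (Q : Type) [AddCommGroup Q] [Module A Q] : Module Aᵐᵒᵖ (DR k A Q) where
  smul a f := ⟨f.1.comp (DistribSMul.toAddMonoidHom Q a.unop), by
    intro c x
    change f.1 (a.unop • algebraMap k A c • x) = c * f.1 (a.unop • x)
    rw [← f.2 c, smul_smul, smul_smul, Algebra.commutes]⟩
  one_smul f := by
    apply Subtype.ext; ext x
    change f.1 ((1 : A) • x) = f.1 x
    rw [one_smul]
  mul_smul a b f := by
    apply Subtype.ext; ext x
    change f.1 ((b.unop * a.unop) • x) = f.1 (b.unop • a.unop • x)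
    rw [mul_smul]
  smul_zero a := rfl
  smul_add a f g := rfl
  add_smul a b f := by
    apply Subtype.ext; ext x
    change f.1 ((a.unop + b.unop) • x) = f.1 (a.unop • x) + f.1 (b.unop • x)
    rw [add_smul, map_add]
  zero_smul f := by
    apply Subtype.ext; ext x
    change f.1 ((0 : A) • x) = 0
    rw [zero_smul, map_zero]

instance DL.instModule (X : Type) [AddCommGroup X] [Module Aᵐᵒᵖ X] : Module A (DL k A X) where
  smul a f := ⟨f.1.comp (DistribSMul.toAddMonoidHom X (op a)), by
    intro c x
    change f.1 (op a • algebraMap k Aᵐᵒᵖ c • x) = c * f.1 (op a • x)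
    rw [← f.2 c, smul_smul, smul_smul, Algebra.commutes]⟩
  one_smul f := by
    apply Subtype.ext; ext x
    change f.1 ((1 : Aᵐᵒᵖ) • x) = f.1 x
    rw [one_smul]
  mul_smul a b f := by
    apply Subtype.ext; ext x
    change f.1 ((op b * op a) • x) = f.1 (op b • op a • x)
    rw [mul_smul]
  smul_zero a := rfl
  smul_add a f g := rfl
  add_smul a b f := by
    apply Subtype.ext; ext x
    change f.1 ((op a + op b) • x) = f.1 (op a • x) + f.1 (op b • x)
    rw [add_smul, map_add]
  zero_smul f := by
    apply Subtype.ext; ext x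
    change f.1 ((0 : Aᵐᵒᵖ) • x) = 0
    rw [zero_smul, map_zero]

theorem DR.smul_apply {Q : Type} [AddCommGroup Q] [Module A Q] (a : A) (f : DR k A Q) (x : Q) :
    (op a • f).1 x = f.1 (a • x) := rfl

theorem DL.smul_apply {X : Type} [AddCommGroup X] [Module Aᵐᵒᵖ X] (a : A) (f : DL k A X) (x : X) :
    (a • f).1 x = f.1 (op a • x) := rfl

/-- linear map into a dual from a balanced pairing. -/
theorem toDR {Q X : Type} [AddCommGroup Q] [Module A Q] [AddCommGroup X] [Module Aᵐᵒᵖ X]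
    (β : X → Q → k) (h1 : ∀ x x' y, β (x + x') y = β x y + β x' y)
    (h2 : ∀ x y y', β x (y + y') = β x y + β x y')
    (h3 : ∀ (c : k) x y, β x (algebraMap k A c • y) = c * β x y)
    (h4 : ∀ (a : A) x y, β (op a • x) y = β x (a • y)) :
    ∃ g : X →ₗ[Aᵐᵒᵖ] DR k A Q, ∀ x y, (g x).1 y = β x y := by
  refine ⟨{ toFun := fun x => ⟨AddMonoidHom.mk' (β x) (h2 x), fun c y => h3 c x y⟩
            map_add' := ?_, map_smul' := ?_ }, fun x y => rfl⟩
  · intro x x'; apply Subtype.ext; ext y; exact h1 x x' y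
  · intro a x; apply Subtype.ext; ext y
    exact h4 a.unop x y

theorem toDL {Q X : Type} [AddCommGroup Q] [Module A Q] [AddCommGroup X] [Module Aᵐᵒᵖ X]
    (β : X → Q → k) (h1 : ∀ x x' y, β (x + x') y = β x y + β x' y)
    (h2 : ∀ x y y', β x (y + y') = β x y + β x y')
    (h3 : ∀ (c : k) x y, β x (algebraMap k A c • y) = c * β x y)
    (h4 : ∀ (a : A) x y, β (op a • x) y = β x (a • y)) :
    ∃ g : Q →ₗ[A] DL k A X, ∀ x y, (g y).1 x = β x y := by
  refine ⟨{ toFun := fun y => ⟨AddMonoidHom.mk' (fun x => β x y) (fun x x' => h1 x x' y),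
              fun c x => ?_⟩
            map_add' := ?_, map_smul' := ?_ }, fun x y => rfl⟩
  · change β (algebraMap k Aᵐᵒᵖ c • x) y = c * β x y
    rw [MulOpposite.algebraMap_apply, h4, h3]
  · intro x x'; apply Subtype.ext; ext y; exact h2 y x x'
  · intro a x; apply Subtype.ext; ext y
    exact (h4 a y x).symm

theorem DR_injective (Q : Type) [AddCommGroup Q] [Module A Q] (hQ : Module.Projective A Q) :
    Module.Injective Aᵐᵒᵖ (DR k A Q) := by
  refine ⟨fun X Y _ _ _ _ f hf g => ?_⟩
  obtain ⟨G, hG⟩ := toDL (k := k) (A := A) (fun (x : X) (y : Q) => (g x).1 y)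
    (by intros; simp) (by intros; simp) (by intro c x y; exact (g x).2 c y)
    (by intro a x y; rw [map_smul]; rfl)
  let res : DL k A Y →ₗ[A] DL k A X :=
    { toFun := fun b => ⟨b.1.comp f.toAddMonoidHom, fun c x => by
        change b.1 (f (algebraMap k Aᵐᵒᵖ c • x)) = c * b.1 (f x)
        rw [map_smul, b.2]⟩
      map_add' := fun b b' => rfl
      map_smul' := fun a b => by
        apply Subtype.ext; ext x
        change b.1 (op a • f x) = b.1 (f (op a • x))
        rw [LinearMap.map_smul] }
  obtain ⟨H, hH⟩ := proj_lift hQ res G (by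
    intro y
    obtain ⟨b, hb, hb'⟩ := functional_ext (k := k) f (G y).1 (G y).2 (by
      intro a ha; rw [show a = 0 from hf (by simpa using ha), map_zero])
    refine ⟨⟨b, hb⟩, ?_⟩
    apply Subtype.ext; ext x; exact hb' x)
  obtain ⟨h, hh⟩ := toDR (k := k) (A := A) (fun (y : Y) (q : Q) => (H q).1 y)
    (by intros; simp) (by intros; simp) (by
      intro c x y
      change (H (algebraMap k A c • y)).1 x = c * (H y).1 x
      rw [map_smul, DL.smul_apply, ← (H y).2, MulOpposite.algebraMap_apply])
    (by intro a x y
        change (H y).1 (op a • x) = (H (a • y)).1 x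
        rw [LinearMap.map_smul, DL.smul_apply])
  refine ⟨h, fun x => ?_⟩
  apply Subtype.ext; ext q
  rw [hh, ← hG, ← hH]; rfl

theorem DR_finite [FiniteDimensional k A] (Q : Type) [AddCommGroup Q] [Module A Q]
    [Module.Finite A Q] : Module.Finite Aᵐᵒᵖ (DR k A Q) := by
  apply finite_of_k k
  letI := kMod k A Q
  letI := kMod k Aᵐᵒᵖ (DR k A Q)
  haveI := finite_k k A Q
  let j : DR k A Q →ₗ[k] Module.Dual k Q :=
    { toFun := fun f => { toFun := f.1, map_add' := map_add f.1, map_smul' := fun c x => f.2 c x }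
      map_add' := fun f g => rfl
      map_smul' := fun c f => by
        ext x
        exact f.2 c x }
  apply Module.Finite.of_injective j
  intro f g h
  apply Subtype.ext; ext x
  exact LinearMap.congr_fun h x

theorem DL_finite [FiniteDimensional k A] (Q : Type) [AddCommGroup Q] [Module Aᵐᵒᵖ Q]
    [Module.Finite Aᵐᵒᵖ Q] : Module.Finite A (DL k A Q) := by
  apply finite_of_k k
  letI := kMod k Aᵐᵒᵖ Q
  letI := kMod k A (DL k A Q)
  haveI := finite_k k Aᵐᵒᵖ Q
  let j : DL k A Q →ₗ[k] Module.Dual k Q :=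
    { toFun := fun f => { toFun := f.1, map_add' := map_add f.1, map_smul' := fun c x => f.2 c x }
      map_add' := fun f g => rfl
      map_smul' := fun c f => by
        ext x
        exact f.2 c x }
  apply Module.Finite.of_injective j
  intro f g h
  apply Subtype.ext; ext x
  exact LinearMap.congr_fun h x

variable (k) in
theorem exists_inj_embed [FiniteDimensional k A] (M : Type) [AddCommGroup M] [Module Aᵐᵒᵖ M]
    [Module.Finite Aᵐᵒᵖ M] : ∃ (J : Mdl Aᵐᵒᵖ) (g : M →ₗ[Aᵐᵒᵖ] J), Module.Finite Aᵐᵒᵖ J ∧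
      Module.Injective Aᵐᵒᵖ J ∧ Function.Injective g := by
  haveI := DL_finite (k := k) (A := A) M
  obtain ⟨n, s, hs⟩ := Module.Finite.exists_fin' A (DL k A M)
  obtain ⟨g, hg⟩ := toDR (k := k) (A := A) (fun (m : M) (y : Fin n → A) => (s y).1 m)
    (by intros; simp) (by intros; simp) (by
      intro c x y
      change (s (algebraMap k A c • y)).1 x = c * (s y).1 x
      rw [map_smul, DL.smul_apply, ← (s y).2, MulOpposite.algebraMap_apply])
    (by intro a x y
        change (s y).1 (op a • x) = (s (a • y)).1 x
        rw [LinearMap.map_smul, DL.smul_apply])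
  refine ⟨ModuleCat.of _ (DR k A (Fin n → A)), g, DR_finite (k := k) (A := A) (Fin n → A),
    DR_injective _ inferInstance, ?_⟩
  rw [injective_iff_map_eq_zero]
  intro m hm
  apply functional_sep (k := k) (R := Aᵐᵒᵖ)
  intro f hf
  obtain ⟨y, hy⟩ := hs ⟨f, hf⟩
  have := hg m y
  rw [hm, hy] at this
  exact this.symm

/-- perfectness of nondegenerate pairings in finite dimension. -/
theorem perf [FiniteDimensional k A] {N M : Type} [AddCommGroup N] [Module Aᵐᵒᵖ N]
    [AddCommGroup M] [Module A M] (φ : N → M → k)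
    (h1 : ∀ n n' m, φ (n + n') m = φ n m + φ n' m)
    (h2 : ∀ n m m', φ n (m + m') = φ n m + φ n m')
    (h3 : ∀ (c : k) n m, φ n ((algebraMap k A c) • m) = c * φ n m)
    (h4 : ∀ (a : A) n m, φ (op a • n) m = φ n (a • m))
    (h5 : ∀ n, (∀ m, φ n m = 0) → n = 0)
    (h6 : ∀ m, (∀ n, φ n m = 0) → m = 0)
    (hfin : Module.Finite A M ∨ Module.Finite Aᵐᵒᵖ N) :
    Module.Finite A M ∧ Module.Finite Aᵐᵒᵖ N ∧
    (∀ f : M →+ k, (∀ (c : k) m, f (algebraMap k A c • m) = c * f m) → ∃ n, ∀ m, φ n m = f m) ∧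
    (∀ f : N →+ k, (∀ (c : k) m, f (algebraMap k Aᵐᵒᵖ c • m) = c * f m) →
      ∃ m, ∀ n, φ n m = f n) := by
  letI := kMod k A M
  letI := kMod k Aᵐᵒᵖ N
  let p : N →ₗ[k] M →ₗ[k] k := LinearMap.mk₂ k φ h1
    (by intro c n m
        change φ (algebraMap k Aᵐᵒᵖ c • n) m = c * φ n m
        rw [MulOpposite.algebraMap_apply, h4, h3]) h2
    (by intro c n m; exact h3 c n m)
  have i1 : Function.Injective p := by
    rw [injective_iff_map_eq_zero]
    intro n hn; exact h5 n (fun m => LinearMap.congr_fun hn m)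
  have i2 : Function.Injective p.flip := by
    rw [injective_iff_map_eq_zero]
    intro n hn; exact h6 n (fun m => LinearMap.congr_fun hn m)
  have hff : Module.Finite k M ∧ Module.Finite k N := by
    rcases hfin with h | h
    · haveI := finite_k k A M
      exact ⟨this, Module.Finite.of_injective p i1⟩
    · haveI := finite_k k Aᵐᵒᵖ N
      exact ⟨Module.Finite.of_injective p.flip i2, this⟩
  haveI := hff.1
  haveI := hff.2
  have hp : p.IsPerfPair := LinearMap.IsPerfPair.of_injective i1 i2
  refine ⟨finite_of_k k A M hff.1, finite_of_k k Aᵐᵒᵖ N hff.2, fun f hf => ?_, fun f hf => ?_⟩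
  · obtain ⟨n, hn⟩ := (LinearMap.IsPerfPair.bijective_left p).2
      { toFun := f, map_add' := map_add f, map_smul' := fun c a => hf c a }
    exact ⟨n, fun m => LinearMap.congr_fun hn m⟩
  · obtain ⟨n, hn⟩ := (LinearMap.IsPerfPair.bijective_right p).2
      { toFun := f, map_add' := map_add f, map_smul' := fun c a => hf c a }
    exact ⟨n, fun m => LinearMap.congr_fun hn m⟩

end Dual
end PT

open CategoryTheory MulOpposite
namespace PT

section MG
variable {A : Type} [Ring A] {P P' M : Type} [AddCommGroup P] [Module Aᵐᵒᵖ P]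
  [AddCommGroup P'] [Module Aᵐᵒᵖ P'] [AddCommGroup M] [Module Aᵐᵒᵖ M]

/-- the map `p ↦ m · g(p)`. -/
def mg (m : M) (g : P →ₗ[Aᵐᵒᵖ] A) : P →ₗ[Aᵐᵒᵖ] M where
  toFun p := op (g p) • m
  map_add' p p' := by rw [map_add, MulOpposite.op_add, add_smul]
  map_smul' a p := by
    rw [map_smul, RingHom.id_apply, smul_smul]
    rfl

@[simp] theorem mg_apply (m : M) (g : P →ₗ[Aᵐᵒᵖ] A) (p : P) : mg m g p = op (g p) • m := rfl

theorem mg_add_left (m m' : M) (g : P →ₗ[Aᵐᵒᵖ] A) : mg (m + m') g = mg m g + mg m' g := by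
  ext p; simp

theorem mg_add_right (m : M) (g g' : P →ₗ[Aᵐᵒᵖ] A) : mg m (g + g') = mg m g + mg m g' := by
  ext p; simp [add_smul]

theorem mg_sub_right (m : M) (g g' : P →ₗ[Aᵐᵒᵖ] A) : mg m (g - g') = mg m g - mg m g' := by
  ext p; simp [sub_smul]

theorem mg_smul (a : A) (m : M) (g : P →ₗ[Aᵐᵒᵖ] A) : mg (op a • m) g = mg m (a • g) := by
  ext p
  simp only [mg_apply, LinearMap.smul_apply, smul_smul, smul_eq_mul, MulOpposite.op_mul]

theorem mg_comp (m : M) (g : P →ₗ[Aᵐᵒᵖ] A) (d : P' →ₗ[Aᵐᵒᵖ] P) :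
    mg m (g.comp d) = (mg m g).comp d := rfl

theorem dual_basis (hP : Module.Projective Aᵐᵒᵖ P) [Module.Finite Aᵐᵒᵖ P] :
    ∃ (n : ℕ) (x : Fin n → P) (γ : Fin n → (P →ₗ[Aᵐᵒᵖ] A)), ∀ p, p = ∑ i, op (γ i p) • x i := by
  obtain ⟨n, s, hs⟩ := Module.Finite.exists_fin' Aᵐᵒᵖ P
  obtain ⟨t, ht⟩ := proj_lift hP s LinearMap.id (fun p => hs p)
  refine ⟨n, fun i => s (Pi.single i 1),
    fun i => { toFun := fun p => (t p i).unop, map_add' := ?_, map_smul' := ?_ }, fun p => ?_⟩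
  · intro p q; simp
  · intro a p; rw [map_smul]; rfl
  · conv_lhs => rw [← LinearMap.id_apply (R := Aᵐᵒᵖ) p, ← ht p]
    simp only [LinearMap.coe_mk, AddHom.coe_mk, op_unop, ← map_smul, ← map_sum]
    congr 1
    ext i
    simp [Finset.sum_apply, Pi.single_apply]

theorem eq_sum_mg {n : ℕ} {x : Fin n → P} {γ : Fin n → (P →ₗ[Aᵐᵒᵖ] A)}
    (h : ∀ p, p = ∑ i, op (γ i p) • x i) (f : P →ₗ[Aᵐᵒᵖ] M) :
    f = ∑ i, mg (f (x i)) (γ i) := by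
  ext p
  conv_lhs => rw [h p]
  simp

end MG

section Min
variable {R : Type} [Ring R] [IsNoetherianRing R]

theorem finite_of_superfluous {P M : Type} [AddCommGroup P] [Module R P] [AddCommGroup M]
    [Module R M] [Module.Finite R M] (f : P →ₗ[R] M) (hf : Function.Surjective f)
    (h : ∀ N : Submodule R P, N ⊔ LinearMap.ker f = ⊤ → N = ⊤) : Module.Finite R P := by
  obtain ⟨n, s, hs⟩ := Module.Finite.exists_fin (R := R) (M := M)
  choose t ht using fun i => hf (s i)
  have : Submodule.span R (Set.range t) = ⊤ := by
    apply h
    rw [eq_top_iff]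
    intro p _
    have hp : f p ∈ Submodule.map f (Submodule.span R (Set.range t)) := by
      rw [Submodule.map_span, ← Set.range_comp]
      have : (f ∘ t) = s := funext ht
      rw [this, hs]; trivial
    obtain ⟨y, hy, hyp⟩ := hp
    refine Submodule.mem_sup.mpr ⟨y, hy, p - y, ?_, by abel⟩
    simp [hyp]
  exact ⟨⟨(Set.finite_range t).toFinset, by simpa using this⟩⟩

theorem minPres_finite {P1 P0 M : Mdl R} [Module.Finite R M] {d1 : P1 →ₗ[R] P0} {d0 : P0 →ₗ[R] M}
    (h : IsMinPres R d1 d0) : Module.Finite R P1 ∧ Module.Finite R P0 := by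
  have h0 : Module.Finite R P0 := finite_of_superfluous d0 h.1.2.1 h.1.2.2
  refine ⟨?_, h0⟩
  refine finite_of_superfluous d1.rangeRestrict d1.surjective_rangeRestrict ?_
  intro N hN
  apply h.2.2.2 N
  rwa [LinearMap.ker_rangeRestrict] at hN
end Min

section Tau
variable {k : Type} [Field k] {A : Type} [Ring A] [Algebra k A] [FiniteDimensional k A]

theorem factor_of_tauRigid (M : Mdl Aᵐᵒᵖ) (hr : TauRigid k A M)
    {P1 P0 : Mdl Aᵐᵒᵖ} [Module.Finite Aᵐᵒᵖ P1] {d1 : P1 →ₗ[Aᵐᵒᵖ] P0} {d0 : P0 →ₗ[Aᵐᵒᵖ] M}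
    (hp : IsMinPres Aᵐᵒᵖ d1 d0) (h : P1 →ₗ[Aᵐᵒᵖ] M) :
    ∃ h' : P0 →ₗ[Aᵐᵒᵖ] M, h'.comp d1 = h := by
  by_contra hcon
  letI := kMod k Aᵐᵒᵖ M
  haveI := kMod_tower k Aᵐᵒᵖ M
  haveI : SMulCommClass Aᵐᵒᵖ k M := ⟨fun a c m => by
    change a • (algebraMap k Aᵐᵒᵖ c) • m = (algebraMap k Aᵐᵒᵖ c) • a • m
    rw [smul_smul, smul_smul, Algebra.commutes]⟩
  let F : Submodule k (P1 →ₗ[Aᵐᵒᵖ] M) :=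
    { carrier := {g | ∃ h' : P0 →ₗ[Aᵐᵒᵖ] M, h'.comp d1 = g}
      zero_mem' := ⟨0, by simp⟩
      add_mem' := by
        rintro _ _ ⟨a, rfl⟩ ⟨b, rfl⟩
        exact ⟨a + b, by rw [LinearMap.add_comp]⟩
      smul_mem' := by
        rintro c _ ⟨a, rfl⟩
        exact ⟨c • a, by rw [LinearMap.smul_comp]⟩ }
  obtain ⟨ξ, hξ, hF⟩ := Submodule.exists_dual_map_eq_bot_of_notMem (p := F) (x := h) hcon inferInstance
  have hF' : ∀ h' : P0 →ₗ[Aᵐᵒᵖ] M, ξ (h'.comp d1) = 0 := by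
    intro h'
    have : ξ (h'.comp d1) ∈ F.map ξ := ⟨_, ⟨h', rfl⟩, rfl⟩
    rw [hF] at this
    simpa using this
  let S : Submodule A (P1 →ₗ[Aᵐᵒᵖ] A) :=
    { carrier := {g | ∃ f : P0 →ₗ[Aᵐᵒᵖ] A, g = f.comp d1}
      zero_mem' := ⟨0, by simp⟩
      add_mem' := by
        rintro _ _ ⟨a, rfl⟩ ⟨b, rfl⟩
        exact ⟨a + b, by rw [LinearMap.add_comp]⟩
      smul_mem' := by
        rintro c _ ⟨a, rfl⟩
        exact ⟨c • a, by rw [LinearMap.smul_comp]⟩ }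
  let q := S.mkQ
  have hq : Function.Surjective q := S.mkQ_surjective
  have hq0 : ∀ g, q g = 0 ↔ ∃ f : P0 →ₗ[Aᵐᵒᵖ] A, g = f.comp d1 := fun g =>
    Submodule.Quotient.mk_eq_zero S
  let T := DR k A ((P1 →ₗ[Aᵐᵒᵖ] A) ⧸ S)
  have hT : IsTau k A M (ModuleCat.of _ T) := by
    refine ⟨P1, P0, d1, d0, hp, ModuleCat.of _ ((P1 →ₗ[Aᵐᵒᵖ] A) ⧸ S), q, hq, hq0,
      fun f t => f.1 t, ?_, ?_, ?_, ?_, ?_, ?_⟩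
    · intro n n' m; rfl
    · intro n m m'; exact map_add n.1 m m'
    · intro c n m; exact n.2 c m
    · intro a n m; rfl
    · intro n hn; apply Subtype.ext; ext m; exact hn m
    · intro m hm
      exact functional_sep (k := k) (R := A) (A := ((P1 →ₗ[Aᵐᵒᵖ] A) ⧸ S)) m
        (fun f hf => hm ⟨f, hf⟩)
  let β : M → ((P1 →ₗ[Aᵐᵒᵖ] A) ⧸ S) → k := fun m t => ξ (mg m (Function.surjInv hq t))
  have hβ : ∀ m g, β m (q g) = ξ (mg m g) := by
    intro m g
    have : q (Function.surjInv hq (q g) - g) = 0 := by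
      rw [map_sub, Function.surjInv_eq hq, sub_self]
    obtain ⟨f, hf⟩ := (hq0 _).mp this
    have h2 : ξ (mg m (Function.surjInv hq (q g)) - mg m g) = 0 := by
      rw [← mg_sub_right, hf, mg_comp, hF']
    rw [map_sub] at h2
    exact sub_eq_zero.mp h2
  obtain ⟨f, hf⟩ := toDR (k := k) (A := A) β
    (by intro m m' t; obtain ⟨g, rfl⟩ := hq t; simp only [hβ, mg_add_left, map_add])
    (by intro m t t'; obtain ⟨g, rfl⟩ := hq t; obtain ⟨g', rfl⟩ := hq t'
        rw [← map_add, hβ, mg_add_right, map_add, hβ, hβ])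
    (by intro c m t; obtain ⟨g, rfl⟩ := hq t
        rw [← map_smul]
        simp only [hβ, ← mg_smul]
        have : mg (op ((algebraMap k A) c) • m) g = c • mg m g := by
          ext p
          change op (g p) • (algebraMap k Aᵐᵒᵖ c) • m = (algebraMap k Aᵐᵒᵖ c) • op (g p) • m
          rw [smul_smul, smul_smul, Algebra.commutes]
        rw [this, map_smul, smul_eq_mul])
    (by intro a m t; obtain ⟨g, rfl⟩ := hq t
        rw [← map_smul]; simp only [hβ, mg_smul])
  have hf0 : f = 0 := hr _ hT f
  apply hξ
  obtain ⟨n, x, γ, hx⟩ := dual_basis (A := A) (P := P1) hp.2.1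
  rw [eq_sum_mg hx h, map_sum]
  apply Finset.sum_eq_zero
  intro i _
  rw [← hβ, ← hf, hf0]
  rfl

theorem tauRigid_of_factor (M : Mdl Aᵐᵒᵖ) [Module.Finite Aᵐᵒᵖ M]
    (H : ∀ (P1 P0 : Mdl Aᵐᵒᵖ) (d1 : P1 →ₗ[Aᵐᵒᵖ] P0) (d0 : P0 →ₗ[Aᵐᵒᵖ] M),
      IsMinPres Aᵐᵒᵖ d1 d0 → ∀ h : P1 →ₗ[Aᵐᵒᵖ] M, ∃ h' : P0 →ₗ[Aᵐᵒᵖ] M, h'.comp d1 = h) :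
    TauRigid k A M := by
  haveI : IsNoetherianRing Aᵐᵒᵖ := isNoetherian_of_tower k inferInstance
  rintro T ⟨P1, P0, d1, d0, hp, Tr, q, hq, hq0, φ, h1, h2, h3, h4, h5, h6⟩ f
  obtain ⟨_, _⟩ := minPres_finite hp
  obtain ⟨n, x, γ, hx⟩ := dual_basis (A := A) (P := P1) hp.2.1
  obtain ⟨n', y, δ, hy⟩ := dual_basis (A := A) (P := P0) hp.1.1
  let Φ : T →+ Tr →+ k := AddMonoidHom.mk' (fun t => AddMonoidHom.mk' (φ t) (h2 t))
    (fun t t' => by ext m; exact h1 t t' m)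
  let Ξ : (P1 →ₗ[Aᵐᵒᵖ] M) →+ k := AddMonoidHom.mk' (fun h => ∑ j, Φ (f (h (x j))) (q (γ j)))
    (fun h h' => by simp [Finset.sum_add_distrib])
  have hΞ : ∀ m g, Ξ (mg m g) = Φ (f m) (q g) := by
    intro m g
    have hg : g = ∑ j, (g (x j)) • γ j := by
      ext p
      conv_lhs => rw [hx p]
      simp
    conv_rhs => rw [hg, map_sum, map_sum]
    change ∑ j, Φ (f ((mg m g) (x j))) (q (γ j)) = _
    apply Finset.sum_congr rfl
    intro j _
    rw [map_smul, mg_apply, map_smul]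
    exact h4 _ _ _
  ext m
  apply h5
  intro t
  obtain ⟨g, rfl⟩ := hq t
  change Φ (f m) (q g) = 0
  rw [← hΞ]
  obtain ⟨h', hh'⟩ := H P1 P0 d1 d0 hp (mg m g)
  have e2 : mg m g = ∑ i, mg (h' (y i)) ((δ i).comp d1) := by
    rw [← hh']
    conv_lhs => rw [eq_sum_mg hy h']
    ext p
    simp
  rw [e2, map_sum]
  apply Finset.sum_eq_zero
  intro i _
  rw [hΞ, (hq0 _).mpr ⟨δ i, rfl⟩, map_zero]
end Tau
end PT

open CategoryTheory MulOpposite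
namespace PT

section Bal
variable {C : Type} [Ring C]

/-- there are no nonzero balanced right-linear maps `M × E → X`. -/
def BalZero (M E X : Type) [AddCommGroup M] [Module Cᵐᵒᵖ M] [AddCommGroup E] [Module C E]
    [Module Cᵐᵒᵖ E] [AddCommGroup X] [Module Cᵐᵒᵖ X] : Prop :=
  ∀ θ : M →+ E →+ X, (∀ (c : C) m e, θ (op c • m) e = θ m (c • e)) →
    (∀ (c : C) m e, θ m (op c • e) = op c • θ m e) → ∀ m e, θ m e = 0

/-- coordinates of a map to a free module. -/
def coord {P : Type} [AddCommGroup P] [Module Cᵐᵒᵖ P] {n : ℕ}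
    (t : P →ₗ[Cᵐᵒᵖ] (Fin n → Cᵐᵒᵖ)) (i : Fin n) : P →ₗ[Cᵐᵒᵖ] C where
  toFun p := (t p i).unop
  map_add' p q := by simp
  map_smul' a p := by rw [map_smul]; rfl

theorem lin_eq_sum {M : Type} [AddCommGroup M] [Module Cᵐᵒᵖ M] {n : ℕ}
    (s : (Fin n → Cᵐᵒᵖ) →ₗ[Cᵐᵒᵖ] M) (v : Fin n → Cᵐᵒᵖ) :
    s v = ∑ i, v i • s (Pi.single i 1) := by
  simp only [← map_smul, ← map_sum]
  congr 1
  ext i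
  simp [Finset.sum_apply, Pi.single_apply]

theorem exists_sum_mg {P M : Type} [AddCommGroup P] [Module Cᵐᵒᵖ P] [AddCommGroup M]
    [Module Cᵐᵒᵖ M] (hP : Module.Projective Cᵐᵒᵖ P) {n : ℕ}
    (s : (Fin n → Cᵐᵒᵖ) →ₗ[Cᵐᵒᵖ] M) (hs : Function.Surjective s) (h : P →ₗ[Cᵐᵒᵖ] M) :
    ∃ G : Fin n → (P →ₗ[Cᵐᵒᵖ] C), h = ∑ i, mg (s (Pi.single i 1)) (G i) := by
  obtain ⟨t, ht⟩ := proj_lift hP s h (fun p => hs _)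
  refine ⟨coord t, ?_⟩
  ext p
  rw [← ht, lin_eq_sum]
  simp [coord]

variable [IsNoetherianRing Cᵐᵒᵖ]

theorem bal_iff {E M W X P2 P1 : Type} [AddCommGroup E] [Module C E] [Module Cᵐᵒᵖ E]
    [AddCommGroup M] [Module Cᵐᵒᵖ M] [Module.Finite Cᵐᵒᵖ M] [AddCommGroup W] [Module Cᵐᵒᵖ W]
    [AddCommGroup X] [Module Cᵐᵒᵖ X] [AddCommGroup P2] [Module Cᵐᵒᵖ P2]
    [AddCommGroup P1] [Module Cᵐᵒᵖ P1]
    (hP2 : Module.Projective Cᵐᵒᵖ P2) (hP1 : Module.Projective Cᵐᵒᵖ P1)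
    (d2 : P2 →ₗ[Cᵐᵒᵖ] P1)
    (q : (P2 →ₗ[Cᵐᵒᵖ] C) →ₗ[C] E) (hq : Function.Surjective q)
    (hq0 : ∀ g : P2 →ₗ[Cᵐᵒᵖ] C, q g = 0 ↔ ∃ f : P1 →ₗ[Cᵐᵒᵖ] C, g = f.comp d2)
    (F2 : C → (P2 →ₗ[Cᵐᵒᵖ] P2)) (hF2 : ∀ c g, q (g.comp (F2 c)) = op c • q g)
    (ω : (P2 →ₗ[Cᵐᵒᵖ] M) →+ W) (hω : Function.Surjective ω)
    (hω0 : ∀ h : P2 →ₗ[Cᵐᵒᵖ] M, ω h = 0 ↔ ∃ f : P1 →ₗ[Cᵐᵒᵖ] M, h = f.comp d2)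
    (hωF : ∀ c h, ω (h.comp (F2 c)) = op c • ω h) :
    (∀ u : W →ₗ[Cᵐᵒᵖ] X, u = 0) ↔ BalZero (C := C) M E X := by
  obtain ⟨n, s, hs⟩ := Module.Finite.exists_fin' Cᵐᵒᵖ M
  constructor
  · intro hu θ hθ1 hθ2
    let m : Fin n → M := fun i => s (Pi.single i 1)
    let S : (Fin n → (P2 →ₗ[Cᵐᵒᵖ] C)) →+ (P2 →ₗ[Cᵐᵒᵖ] M) :=
      AddMonoidHom.mk' (fun G => ∑ i, mg (m i) (G i)) (by
        intro G G'; simp [mg_add_right, Finset.sum_add_distrib])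
    let t : (Fin n → (P2 →ₗ[Cᵐᵒᵖ] C)) →+ X :=
      AddMonoidHom.mk' (fun G => ∑ i, θ (m i) (q (G i))) (by
        intro G G'; simp [Finset.sum_add_distrib])
    have ht : ∀ G, t G = ∑ i, θ (m i) (q (G i)) := fun _ => rfl
    have hS : ∀ G, S G = ∑ i, mg (m i) (G i) := fun _ => rfl
    have hSs : Function.Surjective S := fun h => by
      obtain ⟨G, hG⟩ := exists_sum_mg hP2 s hs h
      exact ⟨G, hG.symm⟩
    have hker : ∀ G, ω (S G) = 0 → t G = 0 := by
      intro G hG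
      obtain ⟨f, hf⟩ := (hω0 _).mp hG
      obtain ⟨F', hF'⟩ := exists_sum_mg hP1 s hs f
      let G' : Fin n → (P2 →ₗ[Cᵐᵒᵖ] C) := fun i => G i - (F' i).comp d2
      have hqG : ∀ i, q (G' i) = q (G i) := by
        intro i
        rw [map_sub, (hq0 ((F' i).comp d2)).mpr ⟨_, rfl⟩, sub_zero]
      have hSG : ∀ p, ∑ i, op (G' i p) • m i = 0 := by
        intro p
        have h1 : (S G) p = f (d2 p) := by rw [hf]; rfl
        rw [hF', hS] at h1
        simp only [LinearMap.sum_apply, mg_apply] at h1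
        simp only [G', LinearMap.sub_apply, LinearMap.comp_apply, MulOpposite.op_sub, sub_smul,
          Finset.sum_sub_distrib, h1]
        exact sub_self _
      let Gt : P2 →ₗ[Cᵐᵒᵖ] (Fin n → Cᵐᵒᵖ) :=
        { toFun := fun p i => op (G' i p)
          map_add' := fun p p' => by ext i; simp
          map_smul' := fun a p => by ext i; simp }
      obtain ⟨l, r, hr⟩ := Module.Finite.exists_fin' Cᵐᵒᵖ (LinearMap.ker s)
      obtain ⟨g', hg'⟩ := proj_lift hP2 ((LinearMap.ker s).subtype.comp r) Gt (by
        intro p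
        obtain ⟨v, hv⟩ := hr ⟨Gt p, by
          rw [LinearMap.mem_ker, lin_eq_sum]; exact hSG p⟩
        refine ⟨v, ?_⟩
        rw [LinearMap.comp_apply, hv]; rfl)
      let ρ : Fin l → Fin n → Cᵐᵒᵖ := fun j => (r (Pi.single j 1)).1
      have hρ : ∀ j, ∑ i, ρ j i • m i = 0 := by
        intro j
        have := (r (Pi.single j 1)).2
        rw [LinearMap.mem_ker, lin_eq_sum] at this
        exact this
      have hG'eq : ∀ i, G' i = ∑ j, (ρ j i).unop • coord g' j := by
        intro i
        ext p
        apply op_injective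
        have h1 : Gt p i = op (G' i p) := rfl
        rw [← h1, ← hg', LinearMap.comp_apply, lin_eq_sum]
        simp [coord, ρ, Finset.sum_apply]
      rw [ht]
      calc ∑ i, θ (m i) (q (G i)) = ∑ i, ∑ j, θ (ρ j i • m i) (q (coord g' j)) := by
            apply Finset.sum_congr rfl
            intro i _
            rw [← hqG, hG'eq, map_sum, map_sum]
            apply Finset.sum_congr rfl
            intro j _
            rw [map_smul, ← hθ1, op_unop]
        _ = ∑ j, ∑ i, θ (ρ j i • m i) (q (coord g' j)) := Finset.sum_comm
        _ = 0 := by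
            apply Finset.sum_eq_zero
            intro j _
            have := congrArg (fun z => θ z (q (coord g' j))) (hρ j)
            simpa using this
    obtain ⟨u, hu'⟩ := factor_surj (R := ℤ) ((ω.comp S).toIntLinearMap)
      (hω.comp hSs) t.toIntLinearMap hker
    have hu'' : ∀ G, u (ω (S G)) = t G := hu'
    let U : W →ₗ[Cᵐᵒᵖ] X :=
      { toFun := u
        map_add' := map_add u
        map_smul' := by
          intro c w
          obtain ⟨h, rfl⟩ := hω w
          obtain ⟨G, rfl⟩ := hSs h
          have : c • ω (S G) = ω (S (fun i => (G i).comp (F2 c.unop))) := by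
            have h2 : S (fun i => (G i).comp (F2 c.unop)) = (S G).comp (F2 c.unop) := by
              ext p; simp [hS]
            rw [h2, hωF, op_unop]
          rw [this, hu'', RingHom.id_apply, hu'', ht, ht, Finset.smul_sum]
          apply Finset.sum_congr rfl
          intro i _
          rw [hF2, hθ2, op_unop] }
    have hU : U = 0 := hu U
    intro x e
    obtain ⟨g, rfl⟩ := hq e
    obtain ⟨v, rfl⟩ := hs x
    have h0 : t (fun i => (v i).unop • g) = 0 := by
      rw [← hu'']
      exact LinearMap.congr_fun hU _
    rw [ht] at h0
    rw [lin_eq_sum, map_sum, AddMonoidHom.finsetSum_apply, ← h0]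
    apply Finset.sum_congr rfl
    intro i _
    rw [q.map_smul, ← hθ1, op_unop]
  · intro hb u
    have hθ : ∀ m (g g' : P2 →ₗ[Cᵐᵒᵖ] C), q g = q g' → u (ω (mg m g)) = u (ω (mg m g')) := by
      intro m g g' h
      have : q (g - g') = 0 := by rw [map_sub, h, sub_self]
      obtain ⟨f, hf⟩ := (hq0 _).mp this
      rw [← sub_eq_zero, ← map_sub, ← map_sub, ← mg_sub_right, hf, mg_comp,
        (hω0 _).mpr ⟨_, rfl⟩, map_zero]
    let β : M → E → X := fun m e => u (ω (mg m (Function.surjInv hq e)))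
    have hβ : ∀ m g, β m (q g) = u (ω (mg m g)) := fun m g =>
      hθ m _ _ (Function.surjInv_eq hq _)
    let θ : M →+ E →+ X := AddMonoidHom.mk' (fun m => AddMonoidHom.mk' (β m) (by
        intro e e'
        obtain ⟨g, rfl⟩ := hq e
        obtain ⟨g', rfl⟩ := hq e'
        rw [← map_add, hβ, hβ, hβ, mg_add_right, map_add, map_add])) (by
      intro m m'
      ext e
      obtain ⟨g, rfl⟩ := hq e
      change β (m + m') (q g) = β m (q g) + β m' (q g)
      rw [hβ, hβ, hβ, mg_add_left, map_add, map_add])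
    have hz : ∀ m e, β m e = 0 := hb θ (by
      intro c m e
      obtain ⟨g, rfl⟩ := hq e
      change β (op c • m) (q g) = β m (c • q g)
      rw [← map_smul, hβ, hβ, mg_smul]) (by
      intro c m e
      obtain ⟨g, rfl⟩ := hq e
      change β m (op c • q g) = op c • β m (q g)
      rw [← hF2, hβ, hβ, mg_comp, hωF, LinearMap.map_smul])
    ext w
    obtain ⟨h, rfl⟩ := hω w
    obtain ⟨G, rfl⟩ := exists_sum_mg hP2 s hs h
    rw [map_sum, map_sum]
    apply Finset.sum_eq_zero
    intro i _
    rw [← hβ, hz]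

end Bal

section Zig
variable {R : Type} [Ring R] {P2 P1 P0 N M I J K : Type}
  [AddCommGroup P2] [Module R P2] [AddCommGroup P1] [Module R P1] [AddCommGroup P0] [Module R P0]
  [AddCommGroup N] [Module R N] [AddCommGroup M] [Module R M] [AddCommGroup I] [Module R I]
  [AddCommGroup J] [Module R J] [AddCommGroup K] [Module R K]

/-- data of a projective resolution and an injective resolution. -/
structure ZD (d2 : P2 →ₗ[R] P1) (d1 : P1 →ₗ[R] P0) (d0 : P0 →ₗ[R] N)
    (i : M →ₗ[R] I) (j : I →ₗ[R] J) (l : J →ₗ[R] K) : Prop where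
  p1 : Module.Projective R P1
  p0 : Module.Projective R P0
  i0 : Module.Injective R I
  i1 : Module.Injective R J
  d2i : Function.Injective d2
  d0s : Function.Surjective d0
  e1 : ∀ x, d1 x = 0 ↔ ∃ y, d2 y = x
  e0 : ∀ x, d0 x = 0 ↔ ∃ y, d1 y = x
  ii : Function.Injective i
  ls : Function.Surjective l
  ej : ∀ x, j x = 0 ↔ ∃ y, i y = x
  el : ∀ x, l x = 0 ↔ ∃ y, j y = x

/-- the zigzag relation computing both descriptions of `Ext²`. -/
def Zig (d2 : P2 →ₗ[R] P1) (d1 : P1 →ₗ[R] P0) (d0 : P0 →ₗ[R] N)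
    (i : M →ₗ[R] I) (j : I →ₗ[R] J) (l : J →ₗ[R] K) (h : P2 →ₗ[R] M) (u : N →ₗ[R] K) : Prop :=
  ∃ (h1 : P1 →ₗ[R] I) (h0 : P0 →ₗ[R] J), (∀ p, h1 (d2 p) = i (h p)) ∧
    (∀ p, h0 (d1 p) = j (h1 p)) ∧ ∀ p, u (d0 p) = l (h0 p)

variable {d2 : P2 →ₗ[R] P1} {d1 : P1 →ₗ[R] P0} {d0 : P0 →ₗ[R] N}
    {i : M →ₗ[R] I} {j : I →ₗ[R] J} {l : J →ₗ[R] K}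

theorem Zig.add {h h' u u'} (a : Zig d2 d1 d0 i j l h u) (b : Zig d2 d1 d0 i j l h' u') :
    Zig d2 d1 d0 i j l (h + h') (u + u') := by
  obtain ⟨a1, a0, x, y, z⟩ := a
  obtain ⟨b1, b0, x', y', z'⟩ := b
  exact ⟨a1 + b1, a0 + b0, by simp [x, x'], by simp [y, y'], by simp [z, z']⟩

theorem Zig.sub {h h' u u'} (a : Zig d2 d1 d0 i j l h u) (b : Zig d2 d1 d0 i j l h' u') :
    Zig d2 d1 d0 i j l (h - h') (u - u') := by
  obtain ⟨a1, a0, x, y, z⟩ := a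
  obtain ⟨b1, b0, x', y', z'⟩ := b
  exact ⟨a1 - b1, a0 - b0, by simp [x, x'], by simp [y, y'], by simp [z, z']⟩

theorem Zig.ex_u (D : ZD d2 d1 d0 i j l) (h : P2 →ₗ[R] M) : ∃ u, Zig d2 d1 d0 i j l h u := by
  obtain ⟨h1, hh1⟩ := inj_ext D.i0 d2 (i.comp h) (by
    intro a ha
    rw [D.d2i (ha.trans (map_zero d2).symm), map_zero])
  obtain ⟨h0, hh0⟩ := inj_ext D.i1 d1 (j.comp h1) (by
    intro a ha
    obtain ⟨y, rfl⟩ := (D.e1 _).mp ha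
    rw [LinearMap.comp_apply, hh1, D.ej]
    exact ⟨_, rfl⟩)
  obtain ⟨u, hu⟩ := factor_surj d0 D.d0s (l.comp h0) (by
    intro a ha
    obtain ⟨y, rfl⟩ := (D.e0 _).mp ha
    rw [LinearMap.comp_apply, hh0, D.el]
    exact ⟨_, rfl⟩)
  exact ⟨u, h1, h0, hh1, hh0, hu⟩

theorem Zig.ex_h (D : ZD d2 d1 d0 i j l) (u : N →ₗ[R] K) : ∃ h, Zig d2 d1 d0 i j l h u := by
  obtain ⟨h0, hh0⟩ := proj_lift D.p0 l (u.comp d0) (fun p => D.ls _)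
  obtain ⟨h1, hh1⟩ := proj_lift D.p1 j (h0.comp d1) (by
    intro p
    rw [← D.el, LinearMap.comp_apply, hh0, LinearMap.comp_apply, (D.e0 _).mpr ⟨_, rfl⟩, map_zero])
  obtain ⟨h, hh⟩ := factor_inj i D.ii (h1.comp d2) (by
    intro p
    rw [← D.ej, LinearMap.comp_apply, hh1, LinearMap.comp_apply, (D.e1 _).mpr ⟨_, rfl⟩, map_zero])
  exact ⟨h, h1, h0, fun p => (hh p).symm, fun p => (hh1 p).symm, fun p => (hh0 p).symm⟩

theorem Zig.bdry_u (D : ZD d2 d1 d0 i j l) {f : P1 →ₗ[R] M} {u : N →ₗ[R] K}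
    (z : Zig d2 d1 d0 i j l (f.comp d2) u) : ∃ b : N →ₗ[R] J, ∀ n, u n = l (b n) := by
  obtain ⟨h1, h0, a, b, c⟩ := z
  obtain ⟨t, ht⟩ := inj_ext D.i0 d1 (h1 - i.comp f) (by
    intro x hx
    obtain ⟨y, rfl⟩ := (D.e1 _).mp hx
    simp [a])
  obtain ⟨w, hw⟩ := factor_surj d0 D.d0s (h0 - j.comp t) (by
    intro x hx
    obtain ⟨y, rfl⟩ := (D.e0 _).mp hx
    have : j (i (f y)) = 0 := (D.ej _).mpr ⟨_, rfl⟩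
    simp [b, ht, this])
  refine ⟨w, fun n => ?_⟩
  obtain ⟨p, rfl⟩ := D.d0s n
  have : l (j (t p)) = 0 := (D.el _).mpr ⟨_, rfl⟩
  simp [hw, c, this]

theorem Zig.bdry_h (D : ZD d2 d1 d0 i j l) {h : P2 →ₗ[R] M} {u : N →ₗ[R] K}
    (z : Zig d2 d1 d0 i j l h u) (b : N →ₗ[R] J) (hb : ∀ n, u n = l (b n)) :
    ∃ f : P1 →ₗ[R] M, h = f.comp d2 := by
  obtain ⟨h1, h0, x, y, w⟩ := z
  obtain ⟨a, ha⟩ := proj_lift D.p0 j (h0 - b.comp d0) (by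
    intro p
    rw [← D.el]
    simp [← w, hb])
  obtain ⟨f, hf⟩ := factor_inj i D.ii (h1 - a.comp d1) (by
    intro p
    have : d0 (d1 p) = 0 := (D.e0 _).mpr ⟨_, rfl⟩
    rw [← D.ej]
    simp [ha, y, this])
  refine ⟨f, ?_⟩
  ext p
  apply D.ii
  have : d1 (d2 p) = 0 := (D.e1 _).mpr ⟨_, rfl⟩
  simp [hf, x, this]

theorem Zig.precomp {h u} (z : Zig d2 d1 d0 i j l h u) (f2 : P2 →ₗ[R] P2) (f1 : P1 →ₗ[R] P1)
    (f0 : P0 →ₗ[R] P0) (μ : N →ₗ[R] N) (c0 : d0.comp f0 = μ.comp d0)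
    (c1 : d1.comp f1 = f0.comp d1) (c2 : d2.comp f2 = f1.comp d2) :
    Zig d2 d1 d0 i j l (h.comp f2) (u.comp μ) := by
  obtain ⟨h1, h0, x, y, w⟩ := z
  refine ⟨h1.comp f1, h0.comp f0, fun p => ?_, fun p => ?_, fun p => ?_⟩
  · have := LinearMap.congr_fun c2 p
    simp only [LinearMap.comp_apply] at this ⊢
    rw [← this, x]
  · have := LinearMap.congr_fun c1 p
    simp only [LinearMap.comp_apply] at this ⊢
    rw [← this, y]
  · have := LinearMap.congr_fun c0 p
    simp only [LinearMap.comp_apply] at this ⊢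
    rw [← this, w]

end Zig
end PT

open CategoryTheory MulOpposite
namespace PT

section SplitPd
variable {R : Type} [Ring R] {I J K : Type}
  [AddCommGroup I] [Module R I] [AddCommGroup J] [Module R J] [AddCommGroup K] [Module R K]

theorem split_of_pd2 (j : I →ₗ[R] J) (l : J →ₗ[R] K) (hI : Module.Injective R I)
    (hJ : Module.Injective R J) (el : ∀ x, l x = 0 ↔ ∃ y, j y = x)
    (hpd : PdLE2 R (ModuleCat.of R (K ⧸ LinearMap.range l))) :
    ∃ r : K →ₗ[R] K, (∀ x, ∃ y, l y = r x) ∧ ∀ y, r (l y) = l y := by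
  obtain ⟨R2, R1, R0, δ2, δ1, δ0, p2, p1, p0, i2, s0, x1, x0⟩ := hpd
  let X := K ⧸ LinearMap.range l
  let π : K →ₗ[R] X := (LinearMap.range l).mkQ
  have hπ : ∀ x, π x = 0 ↔ ∃ y, l y = x := by
    intro x
    rw [← LinearMap.mem_range, ← LinearMap.mem_ker, Submodule.ker_mkQ]
  let δ : R0 →ₗ[R] X := δ0
  have hδ : ∀ x, δ (δ1 x) = 0 := by
    intro x
    have : δ1 x ∈ LinearMap.ker δ0 := x0 ▸ LinearMap.mem_range_self δ1 x
    exact this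
  have h12 : ∀ x, δ1 (δ2 x) = 0 := by
    intro x
    have : δ2 x ∈ LinearMap.ker δ1 := x1 ▸ LinearMap.mem_range_self δ2 x
    exact this
  obtain ⟨t, ht⟩ := proj_lift p0 π δ (fun p => Submodule.mkQ_surjective _ _)
  obtain ⟨a, ha⟩ := proj_lift p1 l (t.comp δ1) (by
    intro p
    rw [← hπ, LinearMap.comp_apply, ht, hδ])
  obtain ⟨b, hb⟩ := proj_lift p2 j (a.comp δ2) (by
    intro p
    rw [← el, LinearMap.comp_apply, ha, LinearMap.comp_apply, h12, map_zero])
  obtain ⟨b', hb'⟩ := inj_ext hI δ2 b (by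
    intro x hx
    rw [i2 (hx.trans (map_zero δ2).symm), map_zero])
  obtain ⟨c, hc⟩ := inj_ext hJ δ1 (a - j.comp b') (by
    intro x hx
    have : x ∈ LinearMap.range δ2 := x1 ▸ hx
    obtain ⟨y, rfl⟩ := this
    simp [hb', hb])
  obtain ⟨s, hs⟩ := factor_surj δ s0 (t - l.comp c) (by
    intro x hx
    have : x ∈ LinearMap.range δ1 := x0 ▸ hx
    obtain ⟨y, rfl⟩ := this
    have h0 : l (j (b' y)) = 0 := (el _).mpr ⟨_, rfl⟩
    have := ha y
    simp only [LinearMap.comp_apply] at this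
    simp [hc, this, h0])
  refine ⟨LinearMap.id - s.comp π, ?_, ?_⟩
  · intro x
    rw [← hπ]
    obtain ⟨p, hp⟩ := s0 (π x)
    have hp' : δ p = π x := hp
    have h0 : π (l (c p)) = 0 := (hπ _).mpr ⟨_, rfl⟩
    simp [← hp', hs, ht, h0]
  · intro y
    have h0 : π (l y) = 0 := (hπ _).mpr ⟨_, rfl⟩
    simp [h0]
end SplitPd

section WSide
variable {k : Type} [Field k] {C : Type} [Ring C] [Algebra k C] [FiniteDimensional k C]

theorem injEnv_finite (k : Type) [Field k] {C : Type} [Ring C] [Algebra k C]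
    [FiniteDimensional k C] {M I : Mdl Cᵐᵒᵖ} [Module.Finite Cᵐᵒᵖ M] (f : M →ₗ[Cᵐᵒᵖ] I)
    (hf : IsInjEnv Cᵐᵒᵖ f) : Module.Finite Cᵐᵒᵖ I := by
  haveI : IsNoetherianRing Cᵐᵒᵖ := isNoetherian_of_tower k inferInstance
  obtain ⟨J, g, hJf, hJ, hg⟩ := exists_inj_embed k (A := C) M
  obtain ⟨t, ht⟩ := inj_ext hJ f g (fun a ha => by
    rw [hf.2.1 (ha.trans (map_zero f).symm), map_zero])
  have : LinearMap.ker t = ⊥ := hf.2.2 _ (by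
    rw [eq_bot_iff]
    rintro x ⟨hx, a, rfl⟩
    have h1 : t (f a) = 0 := hx
    rw [ht] at h1
    have h2 : a = 0 := hg (h1.trans (map_zero g).symm)
    rw [h2, map_zero]
    exact Submodule.zero_mem _)
  exact Module.Finite.of_injective t (LinearMap.ker_eq_bot.mp this)

theorem DR_perf (Q : Type) [AddCommGroup Q] [Module C Q] [Module.Finite C Q]
    (f : DR k C Q →+ k) (hf : ∀ (c : k) m, f (algebraMap k Cᵐᵒᵖ c • m) = c * f m) :
    ∃ y : Q, ∀ β : DR k C Q, β.1 y = f β := by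
  have := perf (k := k) (A := C) (N := DR k C Q) (M := Q) (fun β y => β.1 y)
    (by intros; simp) (by intros; simp) (by intro c β y; exact β.2 c y)
    (by intros; rfl) (by intro β h; apply Subtype.ext; ext y; exact h y)
    (by intro y h; exact functional_sep (k := k) (R := C) y (fun f hf => h ⟨f, hf⟩)) (Or.inl inferInstance)
  exact this.2.2.2 f hf

theorem e1_injective {Q1 Q0 : Type} [AddCommGroup Q1] [Module C Q1] [Module.Finite C Q1]
    [AddCommGroup Q0] [Module C Q0] (e1 : Q1 →ₗ[C] Q0)
    (hmin : ∀ N : Submodule C Q1, N ⊔ LinearMap.ker e1 = ⊤ → N = ⊤)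
    (r : DR k C Q1 →ₗ[Cᵐᵒᵖ] DR k C Q1)
    (hr1 : ∀ β, ∃ α : DR k C Q0, ∀ y, (r β).1 y = α.1 (e1 y))
    (hr2 : ∀ (α : DR k C Q0) (β : DR k C Q1), (∀ y, β.1 y = α.1 (e1 y)) → r β = β) :
    Function.Injective e1 := by
  have key : ∀ y : Q1, ∃ z : Q1, ∀ β : DR k C Q1, β.1 z = (r β).1 y := by
    intro y
    obtain ⟨z, hz⟩ := DR_perf (k := k) Q1 (AddMonoidHom.mk' (fun β => (r β).1 y)
      (by intro a b; simp)) (by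
        intro c m
        change (r (algebraMap k Cᵐᵒᵖ c • m)).1 y = c * (r m).1 y
        rw [map_smul, MulOpposite.algebraMap_apply, DR.smul_apply]
        exact (r m).2 c y)
    exact ⟨z, hz⟩
  choose e he using key
  have sep : ∀ y y' : Q1, (∀ β : DR k C Q1, β.1 y = β.1 y') → y = y' := by
    intro y y' h
    rw [← sub_eq_zero]
    refine functional_sep (k := k) (R := C) _ (fun f hf => ?_)
    rw [map_sub, sub_eq_zero]
    exact h ⟨f, hf⟩
  let e' : Q1 →ₗ[C] Q1 :=
    { toFun := e
      map_add' := by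
        intro x y
        apply sep
        intro β
        rw [he, map_add, map_add, he, he]
      map_smul' := by
        intro a x
        apply sep
        intro β
        rw [he, RingHom.id_apply, ← DR.smul_apply a β, he, LinearMap.map_smul r, DR.smul_apply] }
  have h1 : ∀ y, e1 (e' y) = e1 y := by
    intro y
    rw [← sub_eq_zero]
    refine functional_sep (k := k) (R := C) _ (fun f hf => ?_)
    rw [map_sub, sub_eq_zero]
    let β : DR k C Q1 := ⟨f.comp e1.toAddMonoidHom, by
      intro c x
      change f (e1 (algebraMap k C c • x)) = c * f (e1 x)
      rw [map_smul, hf]⟩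
    have h2 := hr2 ⟨f, hf⟩ β (fun y => rfl)
    have h3 := he y β
    rw [h2] at h3
    exact h3
  have h2 : ∀ y, e1 y = 0 → e' y = 0 := by
    intro y hy
    refine functional_sep (k := k) (R := C) _ (fun f hf => ?_)
    have h3 : f (e' y) = (r ⟨f, hf⟩).1 y := he y ⟨f, hf⟩
    obtain ⟨α, hα⟩ := hr1 ⟨f, hf⟩
    rw [h3, hα, hy, map_zero]
  have h3 : LinearMap.range e' = ⊤ := by
    apply hmin
    rw [eq_top_iff]
    intro y _
    rw [Submodule.mem_sup]
    refine ⟨e' y, ⟨y, rfl⟩, y - e' y, ?_, by abel⟩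
    rw [LinearMap.mem_ker, map_sub, h1, sub_self]
  rw [injective_iff_map_eq_zero]
  intro y hy
  obtain ⟨z, rfl⟩ : y ∈ LinearMap.range e' := h3 ▸ Submodule.mem_top
  rw [h1] at hy
  exact h2 z hy

theorem rep_DC {DC : Mdl Cᵐᵒᵖ} (φ : DC → C → k)
    (h1 : ∀ n n' m, φ (n + n') m = φ n m + φ n' m)
    (h2 : ∀ n m m', φ n (m + m') = φ n m + φ n m')
    (h3 : ∀ (c : k) n m, φ n ((algebraMap k C c) * m) = c * φ n m)
    (h4 : ∀ (a : C) n m, φ (op a • n) m = φ n (a * m))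
    (h5 : ∀ n, (∀ m, φ n m = 0) → n = 0)
    (h6 : ∀ m, (∀ n, φ n m = 0) → m = 0)
    {Q : Type} [AddCommGroup Q] [Module C Q] :
    (∀ g : Q →ₗ[C] C, ∃ u : DC →ₗ[Cᵐᵒᵖ] DR k C Q, ∀ n y, (u n).1 y = φ n (g y)) ∧
    (∀ u : DC →ₗ[Cᵐᵒᵖ] DR k C Q, ∃ g : Q →ₗ[C] C, ∀ n y, (u n).1 y = φ n (g y)) := by
  constructor
  · intro g
    exact toDR (k := k) (A := C) (fun (n : DC) y => φ n (g y)) (by intros; rw [h1])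
      (by intros; rw [map_add, h2]) (by intros; rw [map_smul, smul_eq_mul, h3])
      (by intros; rw [map_smul, smul_eq_mul, h4])
  · intro u
    have hp := (perf (k := k) (A := C) (N := DC) (M := C) φ h1 h2 h3 h4 h5 h6
      (Or.inl inferInstance)).2.2.2
    have key : ∀ y : Q, ∃ m : C, ∀ n, φ n m = (u n).1 y := by
      intro y
      exact hp (AddMonoidHom.mk' (fun n => (u n).1 y) (by intro a b; simp)) (by
        intro c m
        change (u (algebraMap k Cᵐᵒᵖ c • m)).1 y = c * (u m).1 y
        rw [map_smul, MulOpposite.algebraMap_apply, DR.smul_apply]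
        exact (u m).2 c y)
    choose g hg using key
    have sep : ∀ m m' : C, (∀ n, φ n m = φ n m') → m = m' := by
      intro m m' h
      rw [← sub_eq_zero]
      apply h6
      intro n
      have := h2 n (m - m') m'
      rw [sub_add_cancel, h n] at this
      simpa using this.symm
    refine ⟨{ toFun := g, map_add' := ?_, map_smul' := ?_ }, fun n y => (hg y n).symm⟩
    · intro x y
      apply sep
      intro n
      rw [h2, hg, hg, hg, map_add]
    · intro a x
      apply sep
      intro n
      rw [hg, RingHom.id_apply, smul_eq_mul, ← h4, hg, LinearMap.map_smul u, DR.smul_apply]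

theorem homZero_iff_bal (hgl : GlDimLE2 Cᵐᵒᵖ) {E : Type} [AddCommGroup E] [Module C E]
    [Module Cᵐᵒᵖ E] (hE : IsRelExt k C E)
    (M W X : Mdl Cᵐᵒᵖ) [Module.Finite Cᵐᵒᵖ M] (hW : IsTauInvCosyz k C M W) :
    HomZero Cᵐᵒᵖ W X ↔ BalZero (C := C) M E X := by
  haveI : IsNoetherianRing Cᵐᵒᵖ := isNoetherian_of_tower k inferInstance
  haveI : IsNoetherianRing C := isNoetherian_of_tower k inferInstance
  obtain ⟨DC, φ, h1, h2, h3, h4, h5, h6, P2, P1, P0, d2, d1, d0, p2, p1, p0, i2, s0, x1, x0,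
    q, hq, hq0, hc⟩ := hE
  obtain ⟨V, ⟨I, f, hf, ⟨ev⟩⟩, DV, ⟨ψ, g1, g2, g3, g4, g5, g6⟩, Q1, Q0, e1, e0, hmp, qW, hqW,
    hqW0⟩ := hW
  haveI hIf : Module.Finite Cᵐᵒᵖ I := injEnv_finite k f hf
  haveI hVf : Module.Finite Cᵐᵒᵖ V := Module.Finite.equiv ev.symm
  obtain ⟨hDVf, -, hpV, -⟩ := perf (k := k) (A := C) ψ g1 g2 g3 g4 g5 g6 (Or.inr hVf)
  obtain ⟨hQ1f, hQ0f⟩ := minPres_finite hmp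
  obtain ⟨⟨pQ0, e0s, e0m⟩, pQ1, ex, e1m⟩ := hmp
  let ν : I →ₗ[Cᵐᵒᵖ] V := ev.symm.toLinearMap.comp (LinearMap.range f).mkQ
  have hνs : Function.Surjective ν := ev.symm.surjective.comp (Submodule.mkQ_surjective _)
  have hν0 : ∀ x, ν x = 0 ↔ ∃ m, f m = x := by
    intro x
    rw [← LinearMap.mem_range]
    change ev.symm ((LinearMap.range f).mkQ x) = 0 ↔ _
    rw [LinearEquiv.map_eq_zero_iff, ← LinearMap.mem_ker, Submodule.ker_mkQ]
  obtain ⟨j, hj⟩ := toDR (k := k) (A := C) (fun (x : I) (y : Q0) => ψ (ν x) (e0 y))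
    (by intros; rw [map_add, g1]) (by intros; rw [map_add, g2])
    (by intros; rw [map_smul, g3]) (by intros; rw [map_smul, map_smul, g4])
  obtain ⟨l, hl⟩ := toDR (k := k) (A := C) (fun (α : DR k C Q0) (y : Q1) => α.1 (e1 y))
    (by intros; simp) (by intros; simp)
    (by intro c α y; rw [map_smul]; exact α.2 c _)
    (by intros; rw [map_smul]; rfl)
  have e01 : ∀ y, e0 (e1 y) = 0 := by
    intro y
    have : e1 y ∈ LinearMap.ker e0 := ex ▸ LinearMap.mem_range_self e1 y
    exact this
  have ej : ∀ x, j x = 0 ↔ ∃ y, f y = x := by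
    intro x
    rw [← hν0]
    constructor
    · intro h
      apply g5
      intro m
      obtain ⟨y, rfl⟩ := e0s m
      rw [← hj, h]
      rfl
    · intro h
      apply Subtype.ext
      ext y
      have h0 := hj 0 y
      rw [map_zero, map_zero] at h0
      rw [hj, h, ← h0]
  have el : ∀ x, l x = 0 ↔ ∃ y, j y = x := by
    intro α
    constructor
    · intro h
      have hk : ∀ y, e0 y = 0 → α.1 y = 0 := by
        intro y hy
        have : y ∈ LinearMap.range e1 := ex ▸ hy
        obtain ⟨z, rfl⟩ := this
        rw [← hl, h]
        rfl
      obtain ⟨γ, hγ1, hγ2⟩ := functional_ext (k := k) (R := C) e0 α.1 α.2 hk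
      obtain ⟨v, hv⟩ := hpV γ hγ1
      obtain ⟨x, rfl⟩ := hνs v
      refine ⟨x, ?_⟩
      apply Subtype.ext
      ext y
      rw [hj, hv, hγ2]
    · rintro ⟨x, rfl⟩
      apply Subtype.ext
      ext y
      have h0 := g2 (ν x) 0 0
      rw [add_zero] at h0
      have h00 : ψ (ν x) 0 = 0 := by simpa using h0
      rw [hl, hj, e01, h00]
      rfl
  have hJ : Module.Injective Cᵐᵒᵖ (DR k C Q0) := DR_injective Q0 pQ0
  obtain ⟨r, hr1, hr2⟩ := split_of_pd2 j l hf.1 hJ el (hgl _)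
  have e1i : Function.Injective e1 := e1_injective (k := k) e1 e1m r (by
      intro β
      obtain ⟨α, hα⟩ := hr1 β
      exact ⟨α, fun y => by rw [← hα, hl]⟩) (by
      intro α β h
      have : β = l α := by
        apply Subtype.ext
        ext y
        rw [h, hl]
      rw [this, hr2])
  have ls : Function.Surjective l := by
    intro β
    obtain ⟨γ, hγ1, hγ2⟩ := functional_ext (k := k) (R := C) e1 β.1 β.2 (by
      intro a ha
      rw [e1i (ha.trans (map_zero e1).symm), map_zero])
    refine ⟨⟨γ, hγ1⟩, ?_⟩
    apply Subtype.ext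
    ext y
    rw [hl, hγ2]
  have D : ZD d2 d1 d0 f j l :=
    { p1 := p1, p0 := p0, i0 := hf.1, i1 := hJ, d2i := i2, d0s := s0
      e1 := fun x => by rw [← LinearMap.mem_ker, ← x1]; rfl
      e0 := fun x => by rw [← LinearMap.mem_ker, ← x0]; rfl
      ii := hf.2.1, ls := ls, ej := ej, el := el }
  obtain ⟨rep1, rep2⟩ := rep_DC (k := k) φ h1 h2 h3 h4 h5 h6 (Q := Q1)
  obtain ⟨rep1', rep2'⟩ := rep_DC (k := k) φ h1 h2 h3 h4 h5 h6 (Q := Q0)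
  choose U hU using rep1
  have sep : ∀ m m' : C, (∀ n, φ n m = φ n m') → m = m' := by
    intro m m' h
    rw [← sub_eq_zero]
    apply h6
    intro n
    have := h2 n (m - m') m'
    rw [sub_add_cancel, h n] at this
    simpa using this.symm
  have Uadd : ∀ g g', U (g + g') = U g + U g' := by
    intro g g'
    ext n y
    rw [hU, LinearMap.add_apply, h2, LinearMap.add_apply, ← hU, ← hU]
    rfl
  have Usub : ∀ g g', U (g - g') = U g - U g' := by
    intro g g'
    rw [eq_sub_iff_add_eq, ← Uadd, sub_add_cancel]
  have Us : ∀ u, ∃ g, U g = u := by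
    intro u
    obtain ⟨g, hg⟩ := rep2 u
    refine ⟨g, ?_⟩
    ext n y
    rw [hU, hg]
  have Ub : ∀ g, qW g = 0 ↔ ∃ b : DC →ₗ[Cᵐᵒᵖ] DR k C Q0, ∀ n, U g n = l (b n) := by
    intro g
    rw [hqW0]
    constructor
    · rintro ⟨f', rfl⟩
      obtain ⟨b, hb⟩ := rep1' f'
      refine ⟨b, fun n => ?_⟩
      apply Subtype.ext
      ext y
      rw [hU, hl, hb]
      rfl
    · rintro ⟨b, hb⟩
      obtain ⟨f', hf'⟩ := rep2' b
      refine ⟨f', ?_⟩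
      ext y
      apply sep
      intro n
      rw [← hU, hb, hl, hf']
      rfl
  have wd : ∀ h g g', Zig d2 d1 d0 f j l h (U g) → Zig d2 d1 d0 f j l h (U g') → qW g = qW g' := by
    intro h g g' z z'
    rw [← sub_eq_zero, ← map_sub, Ub, Usub]
    have := z.sub z'
    rw [sub_self] at this
    have h0 : (0 : P2 →ₗ[Cᵐᵒᵖ] M) = (0 : P1 →ₗ[Cᵐᵒᵖ] M).comp d2 := by ext; simp
    rw [h0] at this
    exact this.bdry_u D
  have exg : ∀ h : P2 →ₗ[Cᵐᵒᵖ] M, ∃ g, Zig d2 d1 d0 f j l h (U g) := by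
    intro h
    obtain ⟨u, hu⟩ := Zig.ex_u D h
    obtain ⟨g, rfl⟩ := Us u
    exact ⟨g, hu⟩
  choose G hG using exg
  choose μ f0 f1 f2 c5 c0 c1 c2 cq using hc
  refine bal_iff p2 p1 d2 q hq hq0 f2 cq
    (AddMonoidHom.mk' (fun h => qW (G h)) (by
      intro h h'
      rw [← map_add]
      apply wd _ _ _ (hG _)
      rw [Uadd]
      exact (hG h).add (hG h'))) ?_ ?_ ?_
  · intro w
    obtain ⟨g, rfl⟩ := hqW w
    obtain ⟨h, hh⟩ := Zig.ex_h D (U g)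
    exact ⟨h, wd _ _ _ (hG h) hh⟩
  · intro h
    change qW (G h) = 0 ↔ _
    rw [Ub]
    constructor
    · rintro ⟨b, hb⟩
      exact (hG h).bdry_h D b hb
    · rintro ⟨f', rfl⟩
      exact (hG _).bdry_u D
  · intro c h
    change qW (G (h.comp (f2 c))) = op c • qW (G h)
    rw [← map_smul]
    apply wd _ _ _ (hG _)
    have hz := (hG h).precomp (f2 c) (f1 c) (f0 c) (μ c) (c0 c) (c1 c) (c2 c)
    have : U (op c • G h) = (U (G h)).comp (μ c) := by
      ext n y
      rw [hU, LinearMap.comp_apply, hU, c5]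
      rfl
    rw [this]
    exact hz

theorem exists_W (k : Type) [Field k] {C : Type} [Ring C] [Algebra k C]
    [FiniteDimensional k C] (M : Mdl Cᵐᵒᵖ) [Module.Finite Cᵐᵒᵖ M] :
    ∃ W, IsTauInvCosyz k C M W := by
  haveI : IsNoetherianRing Cᵐᵒᵖ := isNoetherian_of_tower k inferInstance
  haveI : IsArtinianRing Cᵐᵒᵖ := isArtinian_of_tower k inferInstance
  haveI : IsArtinianRing C := isArtinian_of_tower k inferInstance
  obtain ⟨J, g, hJf, hJ, hg⟩ := exists_inj_embed k (A := C) M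
  obtain ⟨I, f, hI, hf⟩ := exists_injEnv M J hJ g hg
  let V : Mdl Cᵐᵒᵖ := ModuleCat.of _ (I ⧸ LinearMap.range f)
  haveI : Module.Finite Cᵐᵒᵖ V := inferInstanceAs (Module.Finite Cᵐᵒᵖ (I ⧸ LinearMap.range f))
  haveI := DL_finite (k := k) (A := C) V
  let DV : Mdl C := ModuleCat.of _ (DL k C V)
  haveI : Module.Finite C DV := inferInstanceAs (Module.Finite C (DL k C V))
  obtain ⟨Q1, Q0, e1, e0, _, _, hmp⟩ := exists_minPres DV
  let T : Submodule Cᵐᵒᵖ (Q1 →ₗ[C] C) :=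
    { carrier := {g | ∃ f' : Q0 →ₗ[C] C, g = f'.comp e1}
      zero_mem' := ⟨0, by ext; simp⟩
      add_mem' := by
        rintro _ _ ⟨a, rfl⟩ ⟨b, rfl⟩
        exact ⟨a + b, by ext; simp⟩
      smul_mem' := by
        rintro c _ ⟨a, rfl⟩
        exact ⟨c • a, by ext; simp⟩ }
  refine ⟨ModuleCat.of _ ((Q1 →ₗ[C] C) ⧸ T), V, ⟨I, f, hf, ⟨LinearEquiv.refl _ _⟩⟩, DV, ?_,
    Q1, Q0, e1, e0, hmp, T.mkQ, Submodule.mkQ_surjective _, ?_⟩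
  · refine ⟨fun v f => f.1 v, ?_, ?_, ?_, ?_, ?_, ?_⟩
    · intro n n' m; exact map_add m.1 n n'
    · intro n m m'; rfl
    · intro c n m
      have : (algebraMap k C c • m).1 n = m.1 (op (algebraMap k C c) • n) := DL.smul_apply _ m n
      exact this.trans (m.2 c n)
    · intro a n m; rfl
    · intro n hn
      exact functional_sep (k := k) (R := Cᵐᵒᵖ) n (fun f hf => hn ⟨f, hf⟩)
    · intro m hm
      apply Subtype.ext
      ext n
      exact hm n
  · intro g
    have : T.mkQ g = 0 ↔ g ∈ T := by
      rw [← LinearMap.mem_ker, Submodule.ker_mkQ]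
    exact this
end WSide
end PT

open CategoryTheory MulOpposite
namespace PT

theorem relExt_finite {k : Type} [Field k] {C : Type} [Ring C] [Algebra k C]
    [FiniteDimensional k C] {E : Type} [AddCommGroup E] [Module C E]
    [Module Cᵐᵒᵖ E] (hE : IsRelExt k C E) : Module.Finite C E := by
  haveI : IsNoetherianRing Cᵐᵒᵖ := isNoetherian_of_tower k inferInstance
  haveI : IsNoetherianRing C := isNoetherian_of_tower k inferInstance
  obtain ⟨DC, φ, h1, h2, h3, h4, h5, h6, P2, P1, P0, d2, d1, d0, p2, p1, p0, i2, s0, x1, x0,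
    q, hq, hq0, hc⟩ := hE
  clear hc
  haveI hDC : Module.Finite Cᵐᵒᵖ DC := (perf (k := k) (A := C) (N := DC) (M := C)
    φ h1 h2 h3 h4 h5 h6 (Or.inl inferInstance)).2.1
  have D1 : ∀ x, d1 x = 0 ↔ ∃ y, d2 y = x := fun x => by
    rw [← LinearMap.mem_ker, ← x1]; rfl
  have D0 : ∀ x, d0 x = 0 ↔ ∃ y, d1 y = x := fun x => by
    rw [← LinearMap.mem_ker, ← x0]; rfl
  obtain ⟨n, s, hs⟩ := Module.Finite.exists_fin' Cᵐᵒᵖ DC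
  obtain ⟨m, t, ht⟩ := Module.Finite.exists_fin' Cᵐᵒᵖ (LinearMap.ker s)
  obtain ⟨b1, hb⟩ : ∃ b1 : (Fin m → Cᵐᵒᵖ) →ₗ[Cᵐᵒᵖ] (Fin n → Cᵐᵒᵖ),
      ∀ x, s x = 0 ↔ ∃ y, b1 y = x := by
    refine ⟨(LinearMap.ker s).subtype.comp t, fun x => ⟨fun hx => ?_, ?_⟩⟩
    · obtain ⟨y, hy⟩ := ht ⟨x, hx⟩
      exact ⟨y, congrArg Subtype.val hy⟩
    · rintro ⟨y, rfl⟩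
      exact (t y).2
  let F2 := LinearMap.ker b1
  let b2 : F2 →ₗ[Cᵐᵒᵖ] (Fin m → Cᵐᵒᵖ) := (LinearMap.ker b1).subtype
  have b2i : Function.Injective b2 := Subtype.val_injective
  have hb2 : ∀ x, b1 x = 0 ↔ ∃ y, b2 y = x := by
    intro x
    exact ⟨fun h => ⟨⟨x, h⟩, rfl⟩, by rintro ⟨y, rfl⟩; exact y.2⟩
  have pf1 : Module.Projective Cᵐᵒᵖ (Fin m → Cᵐᵒᵖ) := inferInstance
  have pf0 : Module.Projective Cᵐᵒᵖ (Fin n → Cᵐᵒᵖ) := inferInstance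
  obtain ⟨α0, a0⟩ := proj_lift pf0 d0 s (fun _ => s0 _)
  obtain ⟨α1, a1⟩ := proj_lift pf1 d1 (α0.comp b1) (fun p => by
    rw [← D0, LinearMap.comp_apply, a0, hb]; exact ⟨_, rfl⟩)
  obtain ⟨α2, a2⟩ := factor_inj d2 i2 (α1.comp b2) (fun p => by
    rw [← D1, LinearMap.comp_apply, a1, LinearMap.comp_apply, (hb2 _).mpr ⟨_, rfl⟩, map_zero])
  obtain ⟨β0, B0⟩ := proj_lift p0 s d0 (fun _ => hs _)
  obtain ⟨β1, B1⟩ := proj_lift p1 b1 (β0.comp d1) (fun p => by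
    rw [← hb, LinearMap.comp_apply, B0, D0]; exact ⟨_, rfl⟩)
  obtain ⟨β2, B2⟩ := factor_inj b2 b2i (β1.comp d2) (fun p => by
    rw [← hb2, LinearMap.comp_apply, B1, LinearMap.comp_apply, (D1 _).mpr ⟨_, rfl⟩, map_zero])
  simp only [LinearMap.comp_apply] at a0 a1 a2 B0 B1 B2
  obtain ⟨σ0, S0⟩ := proj_lift p0 d1 (α0.comp β0 - LinearMap.id) (fun p => by
    rw [← D0]; simp [a0, B0])
  simp only [LinearMap.sub_apply, LinearMap.comp_apply, LinearMap.id_apply] at S0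
  obtain ⟨σ1, S1⟩ := proj_lift p1 d2 (α1.comp β1 - LinearMap.id - σ0.comp d1) (fun p => by
    rw [← D1]; simp [a1, B1, S0])
  simp only [LinearMap.sub_apply, LinearMap.comp_apply, LinearMap.id_apply] at S1
  have S2 : ∀ p, α2 (β2 p) = p + σ1 (d2 p) := by
    intro p
    apply i2
    have : d1 (d2 p) = 0 := (D1 _).mpr ⟨_, rfl⟩
    rw [a2, B2, map_add, S1, this, map_zero, sub_zero, add_sub_cancel]
  let T : (F2 →ₗ[Cᵐᵒᵖ] C) →ₗ[C] E :=
    { toFun := fun h => q (h.comp β2)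
      map_add' := by intro a b; rw [LinearMap.add_comp, map_add]
      map_smul' := by intro a b; rw [LinearMap.smul_comp, map_smul]; rfl }
  have hT : Function.Surjective T := by
    intro e
    obtain ⟨g, rfl⟩ := hq e
    refine ⟨g.comp α2, ?_⟩
    change q ((g.comp α2).comp β2) = q g
    rw [← sub_eq_zero, ← map_sub, hq0]
    refine ⟨g.comp σ1, ?_⟩
    ext p
    simp [S2]
  obtain ⟨r, w, hw⟩ := Module.Finite.exists_fin' Cᵐᵒᵖ F2
  let ev : (F2 →ₗ[Cᵐᵒᵖ] C) →ₗ[C] (Fin r → C) :=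
    { toFun := fun h i => h (w (Pi.single i 1))
      map_add' := by intro a b; rfl
      map_smul' := by intro a b; rfl }
  have hev : Function.Injective ev := by
    rw [injective_iff_map_eq_zero]
    intro h hh
    ext y
    obtain ⟨v, rfl⟩ := hw y
    rw [lin_eq_sum w, map_sum]
    apply Finset.sum_eq_zero
    intro i _
    have : h (w (Pi.single i 1)) = 0 := congrFun hh i
    rw [map_smul, this, smul_zero]
  haveI : Module.Finite C (F2 →ₗ[Cᵐᵒᵖ] C) := Module.Finite.of_injective ev hev
  exact Module.Finite.of_surjective T hT

theorem tsze_finite (k : Type) [Field k] (C : Type) [Ring C] [Algebra k C]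
    [FiniteDimensional k C] (E : Type) [AddCommGroup E] [Module C E]
    [Module Cᵐᵒᵖ E] [SMulCommClass C Cᵐᵒᵖ E]
    [Module k E] [IsScalarTower k C E] [IsScalarTower k Cᵐᵒᵖ E] [Module.Finite C E] :
    FiniteDimensional k (TrivSqZeroExt C E) := by
  haveI : Module.Finite k E := Module.Finite.trans C E
  exact inferInstanceAs (Module.Finite k (C × E))
end PT

open CategoryTheory MulOpposite
namespace PT

section EP
variable {R : Type} [Ring R]

theorem ep_self {M R1 R0 : Mdl R} (hext : Ext1Zero R M M) (δ1 : R1 →ₗ[R] R0) (δ0 : R0 →ₗ[R] M)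
    (i1 : Function.Injective δ1) (s0 : Function.Surjective δ0)
    (x0 : ∀ x, δ0 x = 0 ↔ ∃ y, δ1 y = x) (a : R1 →ₗ[R] M) :
    ∃ b : R0 →ₗ[R] M, ∀ y, b (δ1 y) = a y := by
  let T : R1 →ₗ[R] (M × R0) := a.prod (-δ1)
  let Z := (M × R0) ⧸ LinearMap.range T
  let mk : (M × R0) →ₗ[R] Z := (LinearMap.range T).mkQ
  have hmk : ∀ z, mk z = 0 ↔ ∃ y, T y = z := by
    intro z
    rw [← LinearMap.mem_ker, Submodule.ker_mkQ]; rfl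
  have hmks : Function.Surjective mk := Submodule.mkQ_surjective _
  let i : M →ₗ[R] Z := mk.comp (LinearMap.inl R M R0)
  obtain ⟨p, hp⟩ := factor_surj mk hmks (δ0.comp (LinearMap.snd R M R0)) (by
    intro z hz
    obtain ⟨y, rfl⟩ := (hmk _).mp hz
    have : δ0 (δ1 y) = 0 := (x0 _).mpr ⟨_, rfl⟩
    simp [T, this])
  have hi : Function.Injective i := by
    rw [injective_iff_map_eq_zero]
    intro m hm
    obtain ⟨y, hy⟩ := (hmk _).mp hm
    have h1 : a y = m := congrArg Prod.fst hy
    have h2 : -δ1 y = 0 := congrArg Prod.snd hy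
    rw [neg_eq_zero] at h2
    rw [← h1, i1 (h2.trans (map_zero δ1).symm), map_zero]
  have hex : ∀ z, p z = 0 ↔ ∃ m, i m = z := by
    intro z
    obtain ⟨⟨m, r⟩, rfl⟩ := hmks z
    rw [hp]
    constructor
    · intro h
      obtain ⟨y, rfl⟩ := (x0 r).mp h
      refine ⟨m + a y, ?_⟩
      rw [← sub_eq_zero]
      change mk (m + a y, 0) - mk (m, δ1 y) = 0
      rw [← map_sub, hmk]
      exact ⟨y, by simp [T]⟩
    · rintro ⟨m', hm'⟩
      have := hp (m', 0)
      have h2 : mk (m', 0) = mk (m, r) := hm'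
      rw [h2, hp] at this
      simpa using this
  obtain ⟨s, hs⟩ := hext (ModuleCat.of R Z) i p hi (by
      intro m
      obtain ⟨r, rfl⟩ := s0 m
      exact ⟨mk (0, r), hp _⟩) (by
      ext z
      exact (hex z).symm)
  obtain ⟨ρ, hρ⟩ := factor_inj i hi ((LinearMap.id : Z →ₗ[R] Z) - LinearMap.comp (M₂ := M) s p) (by
    intro z
    rw [← hex]
    have := LinearMap.congr_fun hs (p z)
    have h2 : p (s (p z)) = p z := this
    change p (z - s (p z)) = 0
    rw [map_sub, h2, sub_self])
  refine ⟨ρ.comp (mk.comp (LinearMap.inr R M R0)), fun y => ?_⟩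
  apply hi
  change i (ρ (mk (0, δ1 y))) = i (a y)
  have h1 : mk (0, δ1 y) = i (a y) := by
    symm
    rw [← sub_eq_zero]
    change mk (a y, 0) - mk (0, δ1 y) = 0
    rw [← map_sub, hmk]
    exact ⟨y, by simp [T]⟩
  rw [h1, hρ]
  have h2 : p (i (a y)) = 0 := (hex _).mpr ⟨_, rfl⟩
  change i (a y) - s (p (i (a y))) = i (a y)
  rw [h2, map_zero, sub_zero]

theorem EP {M X : Mdl R} (hpt : PartialTilting R M) (hX : MemGen R M X) {N K : Type}
    [AddCommGroup N] [Module R N] [AddCommGroup K] [Module R K] (p : N →ₗ[R] M)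
    (hp : Function.Surjective p) (i : K →ₗ[R] N) (hi : ∀ x, p x = 0 ↔ ∃ y, i y = x)
    (a : K →ₗ[R] X) (ha : ∀ y, i y = 0 → a y = 0) : ∃ b : N →ₗ[R] X, ∀ y, b (i y) = a y := by
  obtain ⟨⟨R1, R0, δ1, δ0, p1, p0, i1, s0, x0⟩, hext⟩ := hpt
  have hx0 : ∀ x, δ0 x = 0 ↔ ∃ y, δ1 y = x := fun x => by
    rw [← LinearMap.mem_ker, ← x0]; rfl
  obtain ⟨d, f, hf⟩ := hX
  obtain ⟨lam, hlam⟩ := proj_lift p0 p δ0 (fun _ => hp _)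
  obtain ⟨κ, hκ⟩ := proj_lift p1 i (lam.comp δ1) (fun r => by
    rw [← hi, LinearMap.comp_apply, hlam, hx0]; exact ⟨_, rfl⟩)
  obtain ⟨a', ha'⟩ := proj_lift p1 f (a.comp κ) (fun _ => hf _)
  choose b' hb' using fun t : Fin d => ep_self hext δ1 δ0 i1 s0 hx0 ((LinearMap.proj t).comp a')
  let b0 : R0 →ₗ[R] X := f.comp (LinearMap.pi b')
  have hb0 : ∀ y, b0 (δ1 y) = a (κ y) := by
    intro y
    have : LinearMap.pi b' (δ1 y) = a' y := by
      ext t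
      exact hb' t y
    change f (LinearMap.pi b' (δ1 y)) = _
    rw [this, ha']; rfl
  let σ : (R0 × K) →ₗ[R] N := lam.coprod i
  have hσ : Function.Surjective σ := by
    intro n
    obtain ⟨r, hr⟩ := s0 (p n)
    obtain ⟨y, hy⟩ := (hi (n - lam r)).mp (by rw [map_sub, hlam, hr, sub_self])
    refine ⟨(r, y), ?_⟩
    simp [σ, hy]
  obtain ⟨b, hb⟩ := factor_surj σ hσ (b0.coprod a) (by
    rintro ⟨r, y⟩ h
    have h' : lam r + i y = 0 := by simpa [σ] using h
    have h1 : δ0 r = 0 := by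
      have := congrArg p h'
      rwa [map_add, hlam, (hi _).mpr ⟨_, rfl⟩, add_zero, map_zero] at this
    obtain ⟨z, rfl⟩ := (hx0 _).mp h1
    have h2 := hκ z
    rw [LinearMap.comp_apply] at h2
    rw [← h2, ← map_add] at h'
    have h3 := ha _ h'
    rw [map_add] at h3
    rw [LinearMap.coprod_apply, hb0, h3])
  refine ⟨b, fun y => ?_⟩
  have := hb (0, y)
  simpa [σ] using this
end EP

section BSide
variable {C : Type} [Ring C] {E : Type} [AddCommGroup E]
  [Module C E] [Module Cᵐᵒᵖ E] [SMulCommClass C Cᵐᵒᵖ E]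

theorem modB_iso (M : Mdl Cᵐᵒᵖ) : ∃ ι : M ≃+ modB C E M,
    ∀ (b : TrivSqZeroExt C E) m, op b • ι m = ι (op b.fst • m) :=
  ⟨AddEquiv.refl _, fun _ _ => rfl⟩

theorem modC_iso (Y : Mdl (TrivSqZeroExt C E)ᵐᵒᵖ) :
    ∃ (YC : Mdl Cᵐᵒᵖ) (ι : Y ≃+ YC),
    ∀ (c : C) m, op c • ι m = ι (op (TrivSqZeroExt.inl c : TrivSqZeroExt C E) • m) :=
  ⟨modAlong (tszeInl C E) Y, AddEquiv.refl _, fun _ _ => rfl⟩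

theorem exists_Z (M X : Mdl Cᵐᵒᵖ) (θ : M →+ E →+ X)
    (h1 : ∀ (c : C) m e, θ (op c • m) e = θ m (c • e))
    (h2 : ∀ (c : C) m e, θ m (op c • e) = op c • θ m e) :
    ∃ (Z : Mdl (TrivSqZeroExt C E)ᵐᵒᵖ) (ζ : (X × M) ≃+ Z), ∀ (b : TrivSqZeroExt C E) x m,
      op b • ζ (x, m) = ζ (op b.fst • x + θ m b.snd, op b.fst • m) := by
  let inst : Module (TrivSqZeroExt C E)ᵐᵒᵖ (X × M) :=
    { smul := fun b z => (op b.unop.fst • z.1 + θ z.2 b.unop.snd, op b.unop.fst • z.2)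
      one_smul := by
        intro z
        change (op (1 : C) • z.1 + θ z.2 0, op (1 : C) • z.2) = z
        simp
      mul_smul := by
        intro b b' z
        change (op (b'.unop.fst * b.unop.fst) • z.1 + θ z.2 (b'.unop.fst • b.unop.snd +
          op b.unop.fst • b'.unop.snd), op (b'.unop.fst * b.unop.fst) • z.2) =
          (op b.unop.fst • (op b'.unop.fst • z.1 + θ z.2 b'.unop.snd) +
            θ (op b'.unop.fst • z.2) b.unop.snd, op b.unop.fst • op b'.unop.fst • z.2)
        rw [map_add, h1, h2, MulOpposite.op_mul, mul_smul, mul_smul, smul_add]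
        congr 1
        abel
      smul_zero := by
        intro b
        change (op b.unop.fst • (0 : X) + θ 0 b.unop.snd, op b.unop.fst • (0 : M)) = 0
        simp
      smul_add := by
        intro b z z'
        change (op b.unop.fst • (z.1 + z'.1) + θ (z.2 + z'.2) b.unop.snd,
          op b.unop.fst • (z.2 + z'.2)) =
          (op b.unop.fst • z.1 + θ z.2 b.unop.snd + (op b.unop.fst • z'.1 + θ z'.2 b.unop.snd),
            op b.unop.fst • z.2 + op b.unop.fst • z'.2)
        rw [smul_add, smul_add, map_add, AddMonoidHom.add_apply]
        congr 1
        abel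
      add_smul := by
        intro b b' z
        change (op (b.unop.fst + b'.unop.fst) • z.1 + θ z.2 (b.unop.snd + b'.unop.snd),
          op (b.unop.fst + b'.unop.fst) • z.2) =
          (op b.unop.fst • z.1 + θ z.2 b.unop.snd + (op b'.unop.fst • z.1 + θ z.2 b'.unop.snd),
            op b.unop.fst • z.2 + op b'.unop.fst • z.2)
        rw [MulOpposite.op_add, add_smul, add_smul, map_add]
        congr 1
        abel
      zero_smul := by
        intro z
        change (op (0 : C) • z.1 + θ z.2 0, op (0 : C) • z.2) = 0
        simp }
  exact ⟨@ModuleCat.of _ _ (X × M) _ inst, AddEquiv.refl _, fun _ _ _ => rfl⟩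

theorem bal_of_factor (M : Mdl Cᵐᵒᵖ) {P1 P0 : Mdl (TrivSqZeroExt C E)ᵐᵒᵖ}
    (d1 : P1 →ₗ[(TrivSqZeroExt C E)ᵐᵒᵖ] P0) (d0 : P0 →ₗ[(TrivSqZeroExt C E)ᵐᵒᵖ] modB C E M)
    (hmp : IsMinPres (TrivSqZeroExt C E)ᵐᵒᵖ d1 d0)
    (hfac : ∀ h : P1 →ₗ[(TrivSqZeroExt C E)ᵐᵒᵖ] modB C E M,
      ∃ h' : P0 →ₗ[(TrivSqZeroExt C E)ᵐᵒᵖ] modB C E M, h'.comp d1 = h)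
    (X : Mdl Cᵐᵒᵖ) (hX : MemGen Cᵐᵒᵖ M X) : BalZero (C := C) M E X := by
  intro θ h1 h2 m e
  obtain ⟨⟨p0, s0, -⟩, p1, x0, -⟩ := hmp
  have hx0 : ∀ x, d0 x = 0 ↔ ∃ y, d1 y = x := fun x => by
    rw [← LinearMap.mem_ker, ← x0]; rfl
  obtain ⟨ι, hι⟩ := modB_iso (E := E) M
  obtain ⟨ιX, hιX⟩ := modB_iso (E := E) X
  obtain ⟨Z, ζ, hζ⟩ := exists_Z M X θ h1 h2
  obtain ⟨d, f, hf⟩ := hX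
  let pr : Z →ₗ[(TrivSqZeroExt C E)ᵐᵒᵖ] modB C E M :=
    { toFun := fun z => ι (ζ.symm z).2
      map_add' := by intro z z'; simp
      map_smul' := by
        intro b z
        obtain ⟨⟨x, m⟩, rfl⟩ := ζ.surjective z
        have := hζ b.unop x m
        rw [op_unop] at this
        rw [this, ζ.symm_apply_apply, ζ.symm_apply_apply, RingHom.id_apply]
        have := hι b.unop m
        rw [op_unop] at this
        exact this.symm }
  have hpr : ∀ x m, pr (ζ (x, m)) = ι m := by
    intro x m
    change ι (ζ.symm (ζ (x, m))).2 = _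
    rw [ζ.symm_apply_apply]
  let inX : modB C E X →ₗ[(TrivSqZeroExt C E)ᵐᵒᵖ] Z :=
    { toFun := fun x => ζ (ιX.symm x, 0)
      map_add' := by intro z z'; rw [← map_add ζ, map_add]; simp
      map_smul' := by
        intro b z
        obtain ⟨x, rfl⟩ := ιX.surjective z
        have := hζ b.unop x 0
        rw [op_unop] at this
        rw [RingHom.id_apply, ιX.symm_apply_apply, this]
        have := hιX b.unop x
        rw [op_unop] at this
        rw [this, ιX.symm_apply_apply]
        simp }
  have hinX : ∀ x, inX (ιX x) = ζ (x, 0) := by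
    intro x
    change ζ (ιX.symm (ιX x), 0) = _
    rw [ιX.symm_apply_apply]
  have inXi : Function.Injective inX := by
    intro x x' h
    have := congrArg Prod.fst (ζ.injective h)
    exact ιX.symm.injective this
  have prin : ∀ x, pr (inX x) = 0 := by
    intro x
    obtain ⟨x, rfl⟩ := ιX.surjective x
    rw [hinX, hpr, map_zero]
  let fB : (Fin d → modB C E M) →ₗ[(TrivSqZeroExt C E)ᵐᵒᵖ] modB C E X :=
    { toFun := fun v => ιX (f (fun t => ι.symm (v t)))
      map_add' := by
        intro v w
        rw [← map_add ιX, ← map_add f]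
        congr 2
        ext t
        simp
      map_smul' := by
        intro b v
        have := hιX b.unop (f (fun t => ι.symm (v t)))
        rw [op_unop] at this
        rw [RingHom.id_apply, this, ← map_smul f]
        congr 2
        ext t
        obtain ⟨m, hm⟩ := ι.surjective (v t)
        have h3 := hι b.unop m
        rw [op_unop] at h3
        rw [Pi.smul_apply, Pi.smul_apply, ← hm, h3, ι.symm_apply_apply, ι.symm_apply_apply] }
  have hfB : Function.Surjective fB := by
    intro x
    obtain ⟨v, hv⟩ := hf (ιX.symm x)
    refine ⟨fun t => ι (v t), ?_⟩
    change ιX (f (fun t => ι.symm (ι (v t)))) = x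
    simp [hv]
  obtain ⟨l, hl⟩ := proj_lift p0 pr d0 (by
    intro p
    refine ⟨ζ (0, ι.symm (d0 p)), ?_⟩
    rw [hpr, ι.apply_symm_apply])
  obtain ⟨a, ha⟩ := factor_inj inX inXi (l.comp d1) (by
    intro y
    have h3 : pr (l (d1 y)) = 0 := by rw [hl, hx0]; exact ⟨_, rfl⟩
    rw [LinearMap.comp_apply]
    obtain ⟨⟨x, m'⟩, hz⟩ := ζ.surjective (l (d1 y))
    rw [← hz, hpr] at h3
    have h4 : m' = 0 := ι.injective (h3.trans (map_zero ι).symm)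
    refine ⟨ιX x, ?_⟩
    rw [hinX, ← hz, h4])
  obtain ⟨a', ha'⟩ := proj_lift p1 fB a (fun _ => hfB _)
  choose h' hh' using fun t : Fin d => hfac ((LinearMap.proj t).comp a')
  have hpi : ∀ y, LinearMap.pi h' (d1 y) = a' y := by
    intro y
    ext t
    exact LinearMap.congr_fun (hh' t) y
  obtain ⟨s, hs⟩ := factor_surj d0 s0 (l - inX.comp (fB.comp (LinearMap.pi h'))) (by
    intro x hx
    obtain ⟨y, rfl⟩ := (hx0 _).mp hx
    have h3 := ha y
    rw [LinearMap.comp_apply] at h3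
    simp only [LinearMap.sub_apply, LinearMap.comp_apply]
    rw [hpi, ha', h3, sub_self])
  obtain ⟨p, hp⟩ := s0 (ι m)
  have h5 : pr (s (ι m)) = ι m := by
    rw [← hp, hs, LinearMap.sub_apply, map_sub, LinearMap.comp_apply, prin, sub_zero, hl]
  obtain ⟨⟨x, m'⟩, hz⟩ := ζ.surjective (s (ι m))
  rw [← hz, hpr] at h5
  have h6 : m' = m := ι.injective h5
  subst h6
  have h7 := hζ (TrivSqZeroExt.inr e) x m'
  rw [hz, ← map_smul, hι] at h7
  simp only [TrivSqZeroExt.fst_inr, TrivSqZeroExt.snd_inr, MulOpposite.op_zero, zero_smul,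
    map_zero, zero_add] at h7
  have h8 := ζ.injective (h7.symm.trans (map_zero ζ).symm)
  exact congrArg Prod.fst h8
end BSide
end PT

open CategoryTheory MulOpposite
namespace PT

section BSide
variable {C : Type} [Ring C] {E : Type} [AddCommGroup E]
  [Module C E] [Module Cᵐᵒᵖ E] [SMulCommClass C Cᵐᵒᵖ E]

theorem factor_of_bal (M : Mdl Cᵐᵒᵖ) (hpt : PartialTilting Cᵐᵒᵖ M)
    (hbal : ∀ X : Mdl Cᵐᵒᵖ, MemGen Cᵐᵒᵖ M X → BalZero (C := C) M E X)
    {P1 P0 : Mdl (TrivSqZeroExt C E)ᵐᵒᵖ}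
    (d1 : P1 →ₗ[(TrivSqZeroExt C E)ᵐᵒᵖ] P0) (d0 : P0 →ₗ[(TrivSqZeroExt C E)ᵐᵒᵖ] modB C E M)
    (hmp : IsMinPres (TrivSqZeroExt C E)ᵐᵒᵖ d1 d0)
    (g : P1 →ₗ[(TrivSqZeroExt C E)ᵐᵒᵖ] modB C E M) :
    ∃ h' : P0 →ₗ[(TrivSqZeroExt C E)ᵐᵒᵖ] modB C E M, h'.comp d1 = g := by
  obtain ⟨⟨p0, s0, -⟩, p1, x0, hmin⟩ := hmp
  have hx0 : ∀ x, d0 x = 0 ↔ ∃ y, d1 y = x := fun x => by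
    rw [← LinearMap.mem_ker, ← x0]; rfl
  obtain ⟨ι, hι⟩ := modB_iso (E := E) M
  have hιs : ∀ (b : TrivSqZeroExt C E) z, ι.symm (op b • z) = op b.fst • ι.symm z := by
    intro b z
    obtain ⟨m, rfl⟩ := ι.surjective z
    rw [hι, ι.symm_apply_apply, ι.symm_apply_apply]
  let S : Submodule Cᵐᵒᵖ M :=
    { carrier := {m | ∃ y, d1 y = 0 ∧ g y = ι m}
      zero_mem' := ⟨0, map_zero d1, by rw [map_zero, map_zero]⟩
      add_mem' := by
        rintro a b ⟨y, hy, hy'⟩ ⟨z, hz, hz'⟩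
        exact ⟨y + z, by rw [map_add, hy, hz, add_zero], by rw [map_add, map_add, hy', hz']⟩
      smul_mem' := by
        rintro c a ⟨y, hy, hy'⟩
        refine ⟨op (TrivSqZeroExt.inl c.unop) • y, by rw [map_smul, hy, smul_zero], ?_⟩
        rw [map_smul, hy', hι, TrivSqZeroExt.fst_inl, op_unop] }
  obtain ⟨X, π, hπs, hπ⟩ : ∃ (X : Mdl Cᵐᵒᵖ) (π : M →ₗ[Cᵐᵒᵖ] X), Function.Surjective π ∧
      ∀ m, π m = 0 ↔ ∃ y, d1 y = 0 ∧ g y = ι m := by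
    refine ⟨ModuleCat.of _ (M ⧸ S), S.mkQ, Submodule.mkQ_surjective S, fun m => ?_⟩
    have : S.mkQ m = 0 ↔ m ∈ S := by rw [← LinearMap.mem_ker, Submodule.ker_mkQ]
    exact this
  have hX : MemGen Cᵐᵒᵖ M X :=
    ⟨1, π.comp (LinearMap.proj 0), fun x => by
      obtain ⟨m, hm⟩ := hπs x
      exact ⟨fun _ => m, hm⟩⟩
  obtain ⟨ιX, hιX⟩ := modB_iso (E := E) X
  let G : P1 →+ X := AddMonoidHom.mk' (fun y => π (ι.symm (g y))) (by intro a b; simp)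
  have hG : ∀ y, G y = π (ι.symm (g y)) := fun _ => rfl
  have hGs : ∀ (b : TrivSqZeroExt C E) y, G (op b • y) = op b.fst • G y := by
    intro b y
    rw [hG, hG, map_smul, hιs, map_smul]
  have hGL : ∀ y, d1 y = 0 → G y = 0 := by
    intro y hy
    rw [hG, hπ]
    exact ⟨y, hy, by rw [ι.apply_symm_apply]⟩
  have hGd : ∀ y y', d1 y = d1 y' → G y = G y' := by
    intro y y' h
    rw [← sub_eq_zero, ← map_sub]
    apply hGL
    rw [map_sub, h, sub_self]
  clear_value G
  let ε : E → TrivSqZeroExt C E := TrivSqZeroExt.inr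
  have hG0 : ∀ e y, G (op (ε e) • y) = 0 := by
    intro e y
    rw [hGs]
    change op (0 : C) • G y = 0
    rw [MulOpposite.op_zero, zero_smul]
  have hd0 : ∀ e p, d0 (op (ε e) • p) = 0 := by
    intro e p
    rw [map_smul]
    obtain ⟨m, hm⟩ := ι.surjective (d0 p)
    rw [← hm, hι]
    change ι (op (0 : C) • m) = 0
    rw [MulOpposite.op_zero, zero_smul, map_zero]
  have exP : ∀ m, ∃ p, d0 p = ι m := fun m => s0 _
  have exY : ∀ p e, ∃ y, d1 y = op (ε e) • p := fun p e => (hx0 _).mp (hd0 e p)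
  have key : ∀ m e, ∃ x : X, ∀ p y, d0 p = ι m → d1 y = op (ε e) • p → G y = x := by
    intro m e
    obtain ⟨p, hp⟩ := exP m
    obtain ⟨y, hy⟩ := exY p e
    refine ⟨G y, fun p' y' hp' hy' => ?_⟩
    obtain ⟨w, hw⟩ := (hx0 (p' - p)).mp (by rw [map_sub, hp, hp', sub_self])
    have h1 : G y' = G (y + op (ε e) • w) := by
      apply hGd
      rw [map_add, map_smul, hw, hy, hy', smul_sub, add_sub_cancel]
    rw [h1, map_add, hG0, add_zero]
  choose T hT using key
  let θ : M →+ E →+ X := AddMonoidHom.mk' (fun m => AddMonoidHom.mk' (T m) (by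
      intro e e'
      obtain ⟨p, hp⟩ := exP m
      obtain ⟨y, hy⟩ := exY p e
      obtain ⟨y', hy'⟩ := exY p e'
      rw [← hT m e p y hp hy, ← hT m e' p y' hp hy', ← map_add]
      symm
      apply hT m (e + e') p _ hp
      have : ε (e + e') = ε e + ε e' := TrivSqZeroExt.inr_add C e e'
      rw [map_add, hy, hy', this, MulOpposite.op_add, add_smul])) (by
    intro m m'
    ext e
    obtain ⟨p, hp⟩ := exP m
    obtain ⟨p', hp'⟩ := exP m'
    obtain ⟨y, hy⟩ := exY p e
    obtain ⟨y', hy'⟩ := exY p' e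
    change T (m + m') e = T m e + T m' e
    rw [← hT m e p y hp hy, ← hT m' e p' y' hp' hy', ← map_add]
    symm
    apply hT (m + m') e (p + p') _ (by rw [map_add, map_add, hp, hp'])
    rw [map_add, hy, hy', smul_add])
  have hT0 : ∀ m e, T m e = 0 := by
    refine hbal X hX θ ?_ ?_
    · intro c m e
      obtain ⟨p, hp⟩ := exP m
      obtain ⟨y, hy⟩ := exY p (c • e)
      change T (op c • m) e = T m (c • e)
      rw [← hT m _ p y hp hy]
      symm
      apply hT (op c • m) e (op (TrivSqZeroExt.inl c : TrivSqZeroExt C E) • p) y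
      · rw [map_smul, hp, hι, TrivSqZeroExt.fst_inl]
      · rw [hy, smul_smul, ← MulOpposite.op_mul]
        congr 2
        exact (TrivSqZeroExt.inl_mul_inr c e).symm
    · intro c m e
      obtain ⟨p, hp⟩ := exP m
      obtain ⟨y, hy⟩ := exY p e
      change T m (op c • e) = op c • T m e
      rw [← hT m _ p y hp hy]
      symm
      have := hGs (TrivSqZeroExt.inl c) y
      rw [TrivSqZeroExt.fst_inl] at this
      rw [← this]
      apply hT m (op c • e) p _ hp
      rw [map_smul, hy, smul_smul, ← MulOpposite.op_mul]
      congr 2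
      exact TrivSqZeroExt.inr_mul_inl c e
  have hGE : ∀ p e y, d1 y = op (ε e) • p → G y = 0 := by
    intro p e y hy
    rw [← hT0 (ι.symm (d0 p)) e]
    exact hT _ e p y (by rw [ι.apply_symm_apply]) hy
  let N : Submodule (TrivSqZeroExt C E)ᵐᵒᵖ P0 :=
    Submodule.span _ {z | ∃ p e, z = op (ε e) • p}
  let A : Submodule (TrivSqZeroExt C E)ᵐᵒᵖ P0 :=
    { carrier := {z | ∃ y, d1 y = z ∧ G y = 0}
      zero_mem' := ⟨0, map_zero d1, map_zero G⟩
      add_mem' := by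
        rintro a b ⟨y, hy, hy'⟩ ⟨z, hz, hz'⟩
        exact ⟨y + z, by rw [map_add, hy, hz], by rw [map_add, hy', hz', add_zero]⟩
      smul_mem' := by
        rintro c a ⟨y, hy, hy'⟩
        refine ⟨c • y, by rw [map_smul, hy], ?_⟩
        have := hGs c.unop y
        rw [op_unop] at this
        rw [this, hy', smul_zero] }
  have hNA : N ≤ A := by
    apply Submodule.span_le.mpr
    rintro z ⟨p, e, rfl⟩
    obtain ⟨y, hy⟩ := exY p e
    exact ⟨y, hy, hGE p e y hy⟩
  have hNG : ∀ y, d1 y ∈ N → G y = 0 := by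
    intro y hy
    obtain ⟨y', h1, h2⟩ := hNA hy
    rw [hGd y y' h1.symm, h2]
  have hNd : ∀ z ∈ N, d0 z = 0 := by
    intro z hz
    obtain ⟨y, h1, -⟩ := hNA hz
    exact (hx0 z).mpr ⟨y, h1⟩
  obtain ⟨QC, ρ, hρ⟩ := modC_iso (ModuleCat.of (TrivSqZeroExt C E)ᵐᵒᵖ (P0 ⧸ N))
  obtain ⟨KC, κ, hκ⟩ := modC_iso P1
  let mk : P0 →ₗ[(TrivSqZeroExt C E)ᵐᵒᵖ] (ModuleCat.of (TrivSqZeroExt C E)ᵐᵒᵖ (P0 ⧸ N)) := N.mkQ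
  have mks : Function.Surjective mk := Submodule.mkQ_surjective N
  have mk0 : ∀ z, mk z = 0 ↔ z ∈ N := by
    intro m
    have : N.mkQ m = 0 ↔ m ∈ N := by rw [← LinearMap.mem_ker, Submodule.ker_mkQ]
    exact this
  clear_value mk
  obtain ⟨dq, hdq⟩ := factor_surj mk mks d0 (fun z hz => hNd z ((mk0 z).mp hz))
  let p : QC →ₗ[Cᵐᵒᵖ] M :=
    { toFun := fun z => ι.symm (dq (ρ.symm z))
      map_add' := by intro a b; simp
      map_smul' := by
        intro c z
        obtain ⟨w, rfl⟩ := ρ.surjective z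
        have := hρ c.unop w
        rw [op_unop] at this
        rw [this, ρ.symm_apply_apply, ρ.symm_apply_apply, map_smul, hιs,
          TrivSqZeroExt.fst_inl, op_unop, RingHom.id_apply] }
  have hp : ∀ z, p (ρ (mk z)) = ι.symm (d0 z) := by
    intro z
    change ι.symm (dq (ρ.symm (ρ (mk z)))) = _
    rw [ρ.symm_apply_apply, hdq]
  let i : KC →ₗ[Cᵐᵒᵖ] QC :=
    { toFun := fun z => ρ (mk (d1 (κ.symm z)))
      map_add' := by intro a b; simp
      map_smul' := by
        intro c z
        obtain ⟨w, rfl⟩ := κ.surjective z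
        have := hκ c.unop w
        rw [op_unop] at this
        rw [this, κ.symm_apply_apply, κ.symm_apply_apply, map_smul, map_smul, ← hρ,
          op_unop, RingHom.id_apply] }
  have hi : ∀ y, i (κ y) = ρ (mk (d1 y)) := by
    intro y
    change ρ (mk (d1 (κ.symm (κ y)))) = _
    rw [κ.symm_apply_apply]
  let a : KC →ₗ[Cᵐᵒᵖ] X :=
    { toFun := fun z => G (κ.symm z)
      map_add' := by intro a b; simp
      map_smul' := by
        intro c z
        obtain ⟨w, rfl⟩ := κ.surjective z
        have := hκ c.unop w
        rw [op_unop] at this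
        rw [this, κ.symm_apply_apply, κ.symm_apply_apply, hGs, TrivSqZeroExt.fst_inl,
          op_unop, RingHom.id_apply] }
  have ha : ∀ y, a (κ y) = G y := by
    intro y
    change G (κ.symm (κ y)) = _
    rw [κ.symm_apply_apply]
  clear_value p i a
  obtain ⟨b, hb⟩ := EP hpt hX p (by
      intro m
      obtain ⟨z, hz⟩ := exP m
      exact ⟨ρ (mk z), by rw [hp, hz, ι.symm_apply_apply]⟩) i (by
      intro x
      obtain ⟨x, rfl⟩ := ρ.surjective x
      obtain ⟨z, rfl⟩ := mks x
      rw [hp]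
      constructor
      · intro h
        have h1 : d0 z = 0 := ι.symm.injective (h.trans (map_zero ι.symm).symm)
        obtain ⟨y, rfl⟩ := (hx0 z).mp h1
        exact ⟨κ y, hi y⟩
      · rintro ⟨y, hy⟩
        obtain ⟨y, rfl⟩ := κ.surjective y
        rw [← hp, ← hy, hi, hp, (hx0 _).mpr ⟨_, rfl⟩, map_zero]) a (by
      intro y hy
      obtain ⟨y, rfl⟩ := κ.surjective y
      rw [hi] at hy
      have h1 : mk (d1 y) = 0 := ρ.injective (hy.trans (map_zero ρ).symm)
      rw [ha]
      exact hNG y ((mk0 _).mp h1))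
  have hbG : ∀ y, b (ρ (mk (d1 y))) = G y := by
    intro y
    rw [← hi, hb, ha]
  let hb' : P0 →ₗ[(TrivSqZeroExt C E)ᵐᵒᵖ] modB C E X :=
    { toFun := fun z => ιX (b (ρ (mk z)))
      map_add' := by intro a b; simp
      map_smul' := by
        intro c z
        have h1 : c • z = op (TrivSqZeroExt.inl c.unop.fst : TrivSqZeroExt C E) • z + op (ε c.unop.snd) • z := by
          rw [← add_smul, ← MulOpposite.op_add]
          congr 1
          apply MulOpposite.unop_injective
          exact (TrivSqZeroExt.inl_fst_add_inr_snd_eq c.unop).symm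
        have h2 : mk (op (ε c.unop.snd) • z) = 0 :=
          (mk0 _).mpr (Submodule.subset_span ⟨z, _, rfl⟩)
        have h3 := hιX c.unop (b (ρ (mk z)))
        rw [op_unop] at h3
        rw [h1, map_add, h2, add_zero, map_smul, ← hρ, map_smul, RingHom.id_apply, h3] }
  have hb'' : ∀ z, hb' z = ιX (b (ρ (mk z))) := fun _ => rfl
  let πB : modB C E M →ₗ[(TrivSqZeroExt C E)ᵐᵒᵖ] modB C E X :=
    { toFun := fun z => ιX (π (ι.symm z))
      map_add' := by intro a b; simp
      map_smul' := by
        intro c z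
        have h3 := hιX c.unop (π (ι.symm z))
        have h4 := hιs c.unop z
        rw [op_unop] at h3 h4
        rw [h4, map_smul, RingHom.id_apply, h3] }
  have hπB : ∀ z, πB z = ιX (π (ι.symm z)) := fun _ => rfl
  obtain ⟨h, hh⟩ := proj_lift p0 πB hb' (by
    intro z
    obtain ⟨m, hm⟩ := hπs (b (ρ (mk z)))
    exact ⟨ι m, by rw [hπB, hb'', ι.symm_apply_apply, hm]⟩)
  refine ⟨h, ?_⟩
  have hker : LinearMap.ker (g - h.comp d1) = ⊤ := by
    apply hmin
    rw [eq_top_iff]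
    intro y _
    have h1 : π (ι.symm (g y - h (d1 y))) = 0 := by
      have h2 := hh (d1 y)
      rw [hπB, hb'', hbG] at h2
      have h3 := ιX.injective h2
      rw [map_sub, map_sub, h3, hG, sub_self]
    obtain ⟨y', hy', hy''⟩ := (hπ _).mp h1
    rw [ι.apply_symm_apply] at hy''
    rw [Submodule.mem_sup]
    refine ⟨y - y', ?_, y', hy', by abel⟩
    rw [LinearMap.mem_ker, LinearMap.sub_apply, LinearMap.comp_apply, map_sub, map_sub, hy', hy'',
      sub_zero]
    abel
  symm
  rw [← sub_eq_zero]
  exact LinearMap.ker_eq_top.mp hker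
end BSide
end PT


theorem partial_tilting_tauB_rigid_iff
    (k : Type) [Field k] (C : Type) [Ring C] [Algebra k C] [FiniteDimensional k C]
    (E : Type) [AddCommGroup E] [Module C E] [Module Cᵐᵒᵖ E] [SMulCommClass C Cᵐᵒᵖ E]
    [Module k E] [IsScalarTower k C E] [IsScalarTower k Cᵐᵒᵖ E]
    (hgl : GlDimEq2 Cᵐᵒᵖ) (hE : IsRelExt k C E)
    (M : Mdl Cᵐᵒᵖ) [Module.Finite Cᵐᵒᵖ M]
    (hpt : PartialTilting Cᵐᵒᵖ M)
    (hpd : ∀ T, IsTau k C M T → PdLE1 Cᵐᵒᵖ T) :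
    TauRigid k (TrivSqZeroExt C E) (modB C E M) ↔
      ∀ W, IsTauInvCosyz k C M W →
        ∀ X, MemGen Cᵐᵒᵖ M X → HomZero Cᵐᵒᵖ W X := by
  haveI : Module.Finite C E := PT.relExt_finite hE
  haveI : FiniteDimensional k (TrivSqZeroExt C E) := PT.tsze_finite k C E
  haveI : IsArtinianRing (TrivSqZeroExt C E)ᵐᵒᵖ := isArtinian_of_tower k inferInstance
  haveI : Module.Finite (TrivSqZeroExt C E)ᵐᵒᵖ (modB C E M) := by
    obtain ⟨ι, hι⟩ := PT.modB_iso (E := E) M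
    obtain ⟨n, s, hs⟩ := Module.Finite.exists_fin (R := Cᵐᵒᵖ) (M := M)
    refine ⟨Submodule.fg_def.mpr ⟨Set.range (fun t => ι (s t)), Set.finite_range _, ?_⟩⟩
    let N : Submodule Cᵐᵒᵖ M :=
      { carrier := {m | ι m ∈ Submodule.span (TrivSqZeroExt C E)ᵐᵒᵖ (Set.range (fun t => ι (s t)))}
        zero_mem' := by
          change ι 0 ∈ Submodule.span (TrivSqZeroExt C E)ᵐᵒᵖ (Set.range (fun t => ι (s t)))
          rw [map_zero]; exact Submodule.zero_mem _
        add_mem' := by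
          intro a b ha hb
          change ι (a + b) ∈ Submodule.span (TrivSqZeroExt C E)ᵐᵒᵖ (Set.range (fun t => ι (s t)))
          rw [map_add]; exact Submodule.add_mem _ ha hb
        smul_mem' := by
          intro c m hm
          have h := hι (TrivSqZeroExt.inl c.unop) m
          rw [TrivSqZeroExt.fst_inl, op_unop] at h
          change ι (c • m) ∈ Submodule.span (TrivSqZeroExt C E)ᵐᵒᵖ (Set.range (fun t => ι (s t)))
          rw [← h]; exact Submodule.smul_mem _ _ hm }
    have hN : (⊤ : Submodule Cᵐᵒᵖ M) ≤ N := by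
      rw [← hs, Submodule.span_le]
      rintro _ ⟨t, rfl⟩
      exact Submodule.subset_span ⟨t, rfl⟩
    rw [eq_top_iff]
    intro z _
    obtain ⟨m, rfl⟩ := ι.surjective z
    exact hN (Submodule.mem_top : m ∈ ⊤)
  constructor
  · intro hr W hW X hX
    rw [PT.homZero_iff_bal hgl.1 hE M W X hW]
    obtain ⟨P1, P0, d1, d0, hf1, hf0, hmp⟩ := PT.exists_minPres (modB C E M)
    exact PT.bal_of_factor M d1 d0 hmp (PT.factor_of_tauRigid (modB C E M) hr hmp) X hX
  · intro H
    obtain ⟨W, hW⟩ := PT.exists_W k M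
    apply PT.tauRigid_of_factor
    intro P1 P0 d1 d0 hmp g
    refine PT.factor_of_bal M hpt (fun X hX => ?_) d1 d0 hmp g
    rw [← PT.homZero_iff_bal hgl.1 hE M W X hW]
    exact H W hW X hX
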